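/- arXiv:math/0104053 — 2 statements merged into one kernel-verified Lean document; each statement's English description precedes it below -/
import Mathlib

section
/- For all integers ν ≥ 1, 0 ≤ s, b ≤ ν, L ≥ 2, and 0 ≤ M ≤ L, the following identity of Laurent polynomials in q holds: Σ over tuples n = (n_1,…,n_ν) of nonnegative integers of q^{N_1²+⋯+N_ν²+N_{s+1}+⋯+N_ν−M(N_1+⋯+N_ν)} ∏_{i=1}^ν [n_i + iL − 2Σ_{l=1}^i N_l − α_{i,s} − α_{i,b} choose n_i]_q = G^ν_{−M,L−M}(ν−s,ν−b,q). -/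
open scoped Classical

noncomputable section

/-- The q-Pochhammer symbol `(q)_n = ∏_{j=1}^n (1 - q^j)`. -/
def qP {F : Type*} [Field F] (q : F) (n : ℕ) : F :=
  ∏ j ∈ Finset.range n, (1 - q ^ (j + 1))

/-- The q-binomial coefficient `[N choose k]_q = (q)_N / ((q)_k (q)_{N-k})`
for `0 ≤ k ≤ N`, and `0` otherwise. -/
def qB {F : Type*} [Field F] (q : F) (N k : ℤ) : F :=
  if 0 ≤ k ∧ k ≤ N then qP q N.toNat / (qP q k.toNat * qP q (N - k).toNat) else 0

/-- `NN n i = N_i = n_i + n_{i+1} + ⋯ + n_ν` (indices 1-based; `n ⟨k⟩` is `n_{k+1}`). -/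
def NN {ν : ℕ} (n : Fin ν → ℕ) (i : ℕ) : ℕ :=
  ∑ k : Fin ν, if i ≤ (k : ℕ) + 1 then n k else 0

/-- `α_{i,s} = max(0, i - s)`. -/
def alph (i s : ℕ) : ℤ := max 0 ((i : ℤ) - s)

/-- The exponent `N_1² + ⋯ + N_ν² + N_{s+1} + ⋯ + N_ν`. -/
def expAG (ν s : ℕ) (nn : Fin ν → ℕ) : ℕ :=
  (∑ i ∈ Finset.Icc 1 ν, (NN nn i) ^ 2) + ∑ i ∈ Finset.Icc (s + 1) ν, NN nn i

/-- The polynomial `B^ν_{s,b}(L,q)` of Foda–Quano–Kirillov type. -/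
def B {F : Type*} [Field F] (ν : ℕ) (s b : ℤ) (L : ℕ) (q : F) : F :=
  ∑ᶠ j : ℤ,
    (q ^ (j * ((2 * j + 1) * (2 * (ν : ℤ) + 3) - 2 * s)) *
        qB q (L : ℤ) (((L : ℤ) + b - s) / 2 + j * (2 * (ν : ℤ) + 3)) -
      q ^ ((2 * j + 1) * ((2 * (ν : ℤ) + 3) * j + s)) *
        qB q (L : ℤ) (((L : ℤ) + b + s) / 2 + j * (2 * (ν : ℤ) + 3)))

/-- `jjf j l = j_l` for `1 ≤ l ≤ ν` (and junk value `0` otherwise). -/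
def jjf {ν : ℕ} (j : Fin ν → ℕ) (l : ℕ) : ℤ :=
  if h : l - 1 < ν then (j ⟨l - 1, h⟩ : ℤ) else 0

/-- The q-multinomial coefficient `[L choose a]^(p)_ν`. -/
def qMulti {F : Type*} [Field F] (ν L : ℕ) (a : ℤ) (p : ℕ) (q : F) : F :=
  ∑ᶠ j : Fin ν → ℕ,
    if (∑ l, (j l : ℤ)) = a then
      q ^ ((∑ l ∈ Finset.Icc 2 ν, jjf j (l - 1) * ((L : ℤ) - jjf j l)) -
            ∑ l ∈ Finset.Icc 1 p, jjf j l) *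
        qB q (L : ℤ) (jjf j ν) * ∏ l ∈ Finset.Icc 2 ν, qB q (jjf j l) (jjf j (l - 1))
    else 0

/-- The polynomial `W^ν_{s,b}(L,q)` of Warnaar type. -/
def W {F : Type*} [Field F] (ν : ℕ) (s : ℤ) (b L : ℕ) (q : F) : F :=
  ∑ᶠ j : ℤ,
    (q ^ (j * ((2 * j + 1) * (2 * (ν : ℤ) + 3) - 2 * s)) *
        qMulti ν L (((ν : ℤ) * ((L : ℤ) + 1) - s - b + 1) / 2 + (2 * (ν : ℤ) + 3) * j) b q -
      q ^ ((2 * j + 1) * ((2 * (ν : ℤ) + 3) * j + s)) *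
        qMulti ν L (((ν : ℤ) * ((L : ℤ) + 1) + s - b + 1) / 2 + (2 * (ν : ℤ) + 3) * j) b q)

/-! ### Bressoud lattice paths -/

/-- Step values: `0 ↦ NE (+1)`, `1 ↦ SE (−1)`, `2 ↦ horizontal (0)`. -/
def stepVal : Fin 3 → ℤ := ![1, -1, 0]

/-- Height of the path after `k` steps, starting at height `s`. -/
def hts (s : ℤ) {n : ℕ} (d : Fin n → Fin 3) (k : ℕ) : ℤ :=
  s + ∑ i ∈ Finset.range k, if h : i < n then stepVal (d ⟨i, h⟩) else 0

/-- The vertex `k` is a peak: it is preceded by a NE step and followed by a SE step. -/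
def IsPeak {n : ℕ} (d : Fin n → Fin 3) (k : ℕ) : Prop :=
  ∃ hk : k < n, 1 ≤ k ∧ d ⟨k - 1, Nat.lt_of_le_of_lt (Nat.sub_le k 1) hk⟩ = 0 ∧ d ⟨k, hk⟩ = 1

/-- `d` encodes a Bressoud path from height `s` to height `b` whose peaks have height `≤ ν`:
SE steps only from positive height, horizontal steps only on the x-axis. -/
def ValidPath (ν : ℕ) (s b : ℤ) {n : ℕ} (d : Fin n → Fin 3) : Prop :=
  hts s d n = b ∧
    (∀ k : Fin n, (d k = 1 → 0 < hts s d (k : ℕ)) ∧ (d k = 2 → hts s d (k : ℕ) = 0)) ∧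
    (∀ k : ℕ, IsPeak d k → hts s d k ≤ (ν : ℤ))

/-- The weight of a Bressoud path starting at x-coordinate `M`:
the sum of the x-coordinates of its peaks. -/
def pwt (M : ℤ) {n : ℕ} (d : Fin n → Fin 3) : ℤ :=
  ∑ k ∈ Finset.range (n + 1), if IsPeak d k then M + (k : ℤ) else 0

/-- `C^ν_{M,L}(s,b,q)`: the weighted count of Bressoud paths from `(M,s)` to `(L,b)`
with no peak higher than `ν`. -/
def Cpoly {F : Type*} [Field F] (ν : ℕ) (M L : ℤ) (s b : ℕ) (q : F) : F :=
  ∑ d ∈ Finset.univ.filter (fun d : Fin (L - M).toNat → Fin 3 => ValidPath ν (s : ℤ) (b : ℤ) d),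
    q ^ pwt M d

/-- `t` is an admissible relative height for the peak at vertex `k`. -/
def RelProp (s : ℤ) {n : ℕ} (d : Fin n → Fin 3) (k t : ℕ) : Prop :=
  0 < t ∧ ∃ k' k'' : ℕ, k' < k ∧ k < k'' ∧ k'' ≤ n ∧
    hts s d k' = hts s d k - t ∧ hts s d k'' = hts s d k - t ∧
    ∀ m : ℕ, k' < m → m < k'' → IsPeak d m →
      hts s d m ≤ hts s d k ∧ (hts s d m = hts s d k → k ≤ m)

/-- The relative height of the peak at vertex `k`: the largest `t` with `RelProp`. -/
def relHt (ν : ℕ) (s : ℤ) {n : ℕ} (d : Fin n → Fin 3) (k : ℕ) : ℕ :=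
  Nat.findGreatest (RelProp s d k) (ν + n)

/-- `P^ν_{M,L}(s,b,n)`: Bressoud paths from `(M,s)` to `(L,b)`, peaks of height at most `ν`,
with exactly `nn j` peaks of relative height `j+1`. -/
def Pset (ν : ℕ) (M L : ℤ) (s b : ℤ) (nn : Fin ν → ℕ) : Finset (Fin (L - M).toNat → Fin 3) :=
  Finset.univ.filter (fun d => ValidPath ν s b d ∧
    ∀ j : Fin ν, ((Finset.range ((L - M).toNat + 1)).filter
      (fun k => IsPeak d k ∧ relHt ν s d k = (j : ℕ) + 1)).card = nn j)

/-! ### Gordon lattice paths -/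

/-- `f` encodes a Gordon path of length `n` from height `s` to height `b`:
`f 0 = s`, `f n = b`, adjacent frequencies sum to at most `ν`; values beyond `n` are `0`. -/
def IsGordon (ν n s b : ℕ) (f : ℕ → ℕ) : Prop :=
  f 0 = s ∧ f n = b ∧ (∀ k, k < n → f k + f (k + 1) ≤ ν) ∧ (∀ k, n < k → f k = 0)

/-- The weight `Σ_{j=M+1}^{L-1} j f_j` of a Gordon path starting at x-coordinate `M`. -/
def gwt (M : ℤ) (n : ℕ) (f : ℕ → ℕ) : ℤ :=
  ∑ k ∈ Finset.Ioo 0 n, (M + (k : ℤ)) * (f k : ℤ)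

/-- `G^ν_{M,L}(s,b,q)`: the weighted count of Gordon paths from `(M,s)` to `(L,b)`. -/
def G {F : Type*} [Field F] (ν : ℕ) (M L : ℤ) (s b : ℕ) (q : F) : F :=
  ∑ᶠ f : ℕ → ℕ, if IsGordon ν (L - M).toNat s b f then q ^ gwt M (L - M).toNat f else 0

/-- `F^ν_{s,b}(L,q)` of (2.21). -/
def Fpoly {F : Type*} [Field F] (ν s b L : ℕ) (q : F) : F :=
  ∑ᶠ nn : Fin ν → ℕ, q ^ expAG ν s nn *
    ∏ i : Fin ν, qB q ((nn i : ℤ) + ((i : ℕ) + 1) * (L : ℤ) -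
      2 * (∑ l ∈ Finset.Icc 1 ((i : ℕ) + 1), (NN nn l : ℤ)) -
      alph ((i : ℕ) + 1) s - alph ((i : ℕ) + 1) b) (nn i)

/-- The left-hand side of (4.2): `F` with the extra `−M(N_1+⋯+N_ν)` in the exponent. -/
def FpolyM {F : Type*} [Field F] (ν s b L M : ℕ) (q : F) : F :=
  ∑ᶠ nn : Fin ν → ℕ,
    q ^ ((expAG ν s nn : ℤ) - (M : ℤ) * ∑ i ∈ Finset.Icc 1 ν, (NN nn i : ℤ)) *
    ∏ i : Fin ν, qB q ((nn i : ℤ) + ((i : ℕ) + 1) * (L : ℤ) -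
      2 * (∑ l ∈ Finset.Icc 1 ((i : ℕ) + 1), (NN nn l : ℤ)) -
      alph ((i : ℕ) + 1) s - alph ((i : ℕ) + 1) b) (nn i)


abbrev K : Type := RatFunc ℚ



/-! ### Auxiliary material for the proof -/

theorem qP_succ' {F : Type*} [Field F] (q : F) (n : ℕ) :
    qP q (n + 1) = qP q n * (1 - q ^ (n + 1)) := by
  simp [qP, Finset.prod_range_succ]

theorem qP_ne {F : Type*} [Field F] (q : F) (hq : ∀ j : ℕ, q ^ (j + 1) ≠ 1) (n : ℕ) :
    qP q n ≠ 0 := by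
  unfold qP
  rw [Finset.prod_ne_zero_iff]
  intro j _ h
  exact hq j (sub_eq_zero.mp h).symm

theorem qB_neg {F : Type*} [Field F] (q : F) (n m : ℤ) (hm : m < 0) : qB q (n + m) n = 0 := by
  unfold qB
  rw [if_neg]
  omega

theorem qB_nat {F : Type*} [Field F] (q : F) (n m : ℕ) :
    qB q ((n : ℤ) + m) n = qP q (n + m) / (qP q n * qP q m) := by
  unfold qB
  rw [if_pos (by omega)]
  congr 2
  congr 1
  omega

theorem qB_zero_right {F : Type*} [Field F] (q : F) (hq : ∀ j : ℕ, q ^ (j + 1) ≠ 1)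
    (m : ℤ) (hm : 0 ≤ m) : qB q m 0 = 1 := by
  obtain ⟨k, rfl⟩ := Int.eq_ofNat_of_zero_le hm
  have := qB_nat q 0 k
  have h := qP_ne q hq k
  simp at this
  rw [this]
  have h0 : qP q 0 = 1 := by simp [qP]
  rw [h0]
  field_simp

theorem qB_pascal {F : Type*} [Field F] (q : F) (hq : ∀ j : ℕ, q ^ (j + 1) ≠ 1)
    (n : ℕ) (m : ℤ) (h : ¬ (n = 0 ∧ m = 0)) :
    qB q ((n : ℤ) + m) n = qB q ((n : ℤ) + (m - 1)) n
      + q ^ m * qB q ((n : ℤ) - 1 + m) ((n : ℤ) - 1) := by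
  rcases lt_trichotomy m 0 with hm | hm | hm
  · rw [qB_neg q _ _ hm, qB_neg q _ _ (by omega : m - 1 < 0), qB_neg q _ _ hm]
    simp
  · subst hm
    obtain ⟨k, rfl⟩ : ∃ k, n = k + 1 := ⟨n - 1, by omega⟩
    have h1 := qB_nat q (k + 1) 0
    have h2 := qB_nat q k 0
    have a := qP_ne q hq k
    have b := qP_ne q hq (k + 1)
    have h0 : qP q 0 = 1 := by simp [qP]
    rw [qB_neg q _ _ (by omega : (0 : ℤ) - 1 < 0)]
    have e : ((k + 1 : ℕ) : ℤ) - 1 = k := by push_cast; ring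
    rw [e]
    simp only [Nat.cast_zero] at h1 h2
    rw [h1, h2, h0]
    simp only [add_zero, zero_add, zpow_zero, one_mul, mul_one]
    rw [div_self a, div_self b]
  · obtain ⟨m', rfl⟩ : ∃ m' : ℕ, m = (m' + 1 : ℕ) := ⟨(m - 1).toNat, by omega⟩
    rcases Nat.eq_zero_or_pos n with rfl | hn
    · have : qB q (((0 : ℕ) : ℤ) - 1 + ((m' + 1 : ℕ) : ℤ)) (((0 : ℕ) : ℤ) - 1) = 0 := by
        unfold qB
        rw [if_neg]
        omega
      rw [this]
      simp only [Nat.cast_zero, zero_add, mul_zero, add_zero]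
      rw [qB_zero_right q hq _ (by omega), qB_zero_right q hq _ (by omega)]
    · obtain ⟨k, rfl⟩ : ∃ k, n = k + 1 := ⟨n - 1, by omega⟩
      have e : ((k + 1 : ℕ) : ℤ) - 1 = k := by push_cast; ring
      have e' : ((m' + 1 : ℕ) : ℤ) - 1 = m' := by push_cast; ring
      rw [e, e', qB_nat, qB_nat, qB_nat, zpow_natCast]
      have e1 : k + 1 + (m' + 1) = (k + m' + 1) + 1 := by ring
      have e2 : k + 1 + m' = k + m' + 1 := by ring
      have e3 : k + (m' + 1) = k + m' + 1 := by ring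
      rw [e1, e2, e3, qP_succ' q (k + m' + 1), qP_succ' q k, qP_succ' q m']
      have a := qP_ne q hq k
      have b := qP_ne q hq m'
      have a' : 1 - q ^ (k + 1) ≠ 0 := fun h => hq k (sub_eq_zero.mp h).symm
      have b' : 1 - q ^ (m' + 1) ≠ 0 := fun h => hq m' (sub_eq_zero.mp h).symm
      field_simp
      ring

/-- `m_k = u_k - 2 (N_1 + ⋯ + N_k)`. -/
def mmv {ν : ℕ} (u : ℕ → ℤ) (n : Fin ν → ℕ) (k : ℕ) : ℤ :=
  u k - 2 * ∑ l ∈ Finset.Icc 1 k, (NN n l : ℤ)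

/-- The exponent. -/
def EE {ν : ℕ} (w : ℕ → ℤ) (n : Fin ν → ℕ) : ℤ :=
  ∑ l ∈ Finset.Icc 1 ν, ((NN n l : ℤ) ^ 2 + w l * NN n l)

/-- The summand. -/
def TT {F : Type*} [Field F] {ν : ℕ} (q : F) (w u : ℕ → ℤ) (n : Fin ν → ℕ) : F :=
  q ^ EE w n * ∏ i : Fin ν, qB q ((n i : ℤ) + mmv u n ((i : ℕ) + 1)) (n i)

/-- The general fermionic sum. -/
def SS {F : Type*} [Field F] (ν : ℕ) (q : F) (w u : ℕ → ℤ) : F :=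
  ∑ᶠ n : Fin ν → ℕ, TT q w u n

theorem TT_zero {F : Type*} [Field F] {ν : ℕ} (q : F) (w u : ℕ → ℤ) (n : Fin ν → ℕ)
    (k : ℕ) (hk : 1 ≤ k) (hk' : k ≤ ν) (h : mmv u n k < 0) : TT q w u n = 0 := by
  unfold TT
  rw [Finset.prod_eq_zero (i := (⟨k - 1, by omega⟩ : Fin ν)) (Finset.mem_univ _), mul_zero]
  apply qB_neg
  simpa [Nat.sub_add_cancel hk] using h

theorem NN_le {ν : ℕ} (n : Fin ν → ℕ) (i : Fin ν) : n i ≤ NN n 1 := by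
  unfold NN
  simp only [Nat.le_add_left, if_true]
  exact Finset.single_le_sum (f := n) (fun _ _ => Nat.zero_le _) (Finset.mem_univ i)

theorem TT_fin {F : Type*} [Field F] {ν : ℕ} (hν : 1 ≤ ν) (q : F) (w u : ℕ → ℤ) :
    (Function.support (TT (ν := ν) q w u)).Finite := by
  apply Set.Finite.subset (Set.finite_Iic (fun _ : Fin ν => (u 1).toNat))
  intro n hn
  rw [Function.mem_support] at hn
  rw [Set.mem_Iic]
  intro i
  by_contra hlt
  apply hn
  apply TT_zero q w u n 1 le_rfl hν
  have := NN_le n i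
  simp only [mmv, Finset.Icc_self, Finset.sum_singleton]
  simp only at hlt
  omega

theorem NN_succ {ν : ℕ} (n : Fin ν → ℕ) (i : Fin ν) :
    NN n ((i : ℕ) + 1) = n i + NN n ((i : ℕ) + 2) := by
  unfold NN
  have : n i = ∑ k : Fin ν, if k = i then n k else 0 := by simp
  conv_rhs => rw [this]
  rw [← Finset.sum_add_distrib]
  apply Finset.sum_congr rfl
  intro k _
  by_cases h : k = i
  · subst h; simp
  · have : (k : ℕ) ≠ i := fun h' => h (Fin.ext h')
    simp only [h, if_false, zero_add]
    congr 1
    apply propext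
    omega

theorem NN_top {ν : ℕ} (n : Fin ν → ℕ) (k : ℕ) (hk : ν < k) : NN n k = 0 := by
  unfold NN
  apply Finset.sum_eq_zero
  intro i _
  rw [if_neg]
  omega

theorem NN_add {ν : ℕ} (n : Fin ν → ℕ) (i : Fin ν) (l : ℕ) :
    NN (n + Pi.single i 1) l = NN n l + if l ≤ (i : ℕ) + 1 then 1 else 0 := by
  unfold NN
  have : (if l ≤ (i : ℕ) + 1 then 1 else 0)
      = ∑ k : Fin ν, if l ≤ (k : ℕ) + 1 then (Pi.single i 1 : Fin ν → ℕ) k else 0 := by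
    rw [Finset.sum_eq_single i]
    · simp
    · intro b _ hb
      simp [hb]
    · simp
  rw [this, ← Finset.sum_add_distrib]
  apply Finset.sum_congr rfl
  intro k _
  split_ifs <;> simp

theorem mmv_succ {ν : ℕ} (u : ℕ → ℤ) (n : Fin ν → ℕ) (k : ℕ) :
    mmv u n (k + 1) = mmv u n k + u (k + 1) - u k - 2 * NN n (k + 1) := by
  unfold mmv
  rw [Finset.sum_Icc_succ_top (by omega)]
  ring

theorem mmv_zero {ν : ℕ} (u : ℕ → ℤ) (n : Fin ν → ℕ) : mmv u n 0 = u 0 := by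
  simp [mmv]

/-- `min(i,k)` as an integer function of `i`. -/
def mn (k i : ℕ) : ℤ := min (i : ℤ) k

/-- indicator of `j ≤ i`. -/
def st (j i : ℕ) : ℤ := if j ≤ i then 1 else 0

theorem sum_ite_le (k i : ℕ) (f : ℕ → ℤ) :
    ∑ l ∈ Finset.Icc 1 k, (if l ≤ i then f l else 0) = ∑ l ∈ Finset.Icc 1 (min k i), f l := by
  rw [← Finset.sum_filter]
  congr 1
  ext l
  simp
  omega

theorem mmv_add {ν : ℕ} (u : ℕ → ℤ) (n : Fin ν → ℕ) (i : Fin ν) (k : ℕ) :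
    mmv u (n + Pi.single i 1) k = mmv (fun x => u x - 2 * mn ((i : ℕ) + 1) x) n k := by
  unfold mmv
  simp only [NN_add]
  push_cast
  rw [Finset.sum_add_distrib, sum_ite_le k _ (fun _ => 1)]
  simp [mn]
  ring

theorem EE_add {ν : ℕ} (w : ℕ → ℤ) (n : Fin ν → ℕ) (i : Fin ν) :
    EE w (n + Pi.single i 1) = EE w n + ∑ l ∈ Finset.Icc 1 ((i : ℕ) + 1), (2 * (NN n l : ℤ) + 1 + w l) := by
  unfold EE
  have h : min ν ((i : ℕ) + 1) = (i : ℕ) + 1 := by omega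
  have := sum_ite_le ν ((i : ℕ) + 1) (fun l => 2 * (NN n l : ℤ) + 1 + w l)
  rw [h] at this
  rw [← this, ← Finset.sum_add_distrib]
  apply Finset.sum_congr rfl
  intro l _
  rw [NN_add]
  split_ifs <;> push_cast <;> ring

theorem SS_congr {F : Type*} [Field F] (ν : ℕ) (q : F) (w u u' : ℕ → ℤ)
    (h : ∀ k, 1 ≤ k → k ≤ ν → u k = u' k) : SS ν q w u = SS ν q w u' := by
  unfold SS
  apply finsum_congr
  intro n
  unfold TT
  congr 1
  apply Finset.prod_congr rfl
  intro i _
  unfold mmv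
  rw [h _ (by omega) (by omega)]

/-- The fundamental recurrence. -/
theorem SS_rec {F : Type*} [Field F] (ν : ℕ) (q : F) (hq0 : q ≠ 0)
    (hq : ∀ j : ℕ, q ^ (j + 1) ≠ 1) (w v : ℕ → ℤ) (hv0 : v 0 = 0) (j : ℕ) (hj : 1 ≤ j)
    (hjν : j ≤ ν) (hc : j < ν → v (j + 1) - 2 * v j + v (j - 1) ≤ 0)
    (hc' : j = ν → v (j - 1) ≤ v j) :
    SS ν q w (fun x => v x + st j x) = SS ν q w (fun x => v x + st (j + 1) x)
      + q ^ (v j + 1 - j + ∑ l ∈ Finset.Icc 1 j, w l)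
        * SS ν q w (fun x => v x + st j x - 2 * mn j x) := by
  obtain ⟨i, rfl⟩ : ∃ i, j = i + 1 := ⟨j - 1, by omega⟩
  simp only [Nat.add_sub_cancel] at hc hc'
  set I : Fin ν := ⟨i, by omega⟩ with hI
  set u : ℕ → ℤ := fun x => v x + st (i + 1) x with hu
  set u' : ℕ → ℤ := fun x => v x + st (i + 1 + 1) x with hu'
  set φ : (Fin ν → ℕ) → (Fin ν → ℕ) := fun n => n + Pi.single I 1 with hφ
  have hφi : Function.Injective φ := fun a b hab => by simpa [hφ] using hab
  have huu : u' (i + 1) = u (i + 1) - 1 := by simp [hu, hu', st]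
  have huu2 : ∀ k, k ≠ i + 1 → u' k = u k := by
    intro k hk
    simp only [hu, hu', st]
    congr 2
    apply propext
    omega
  have hmm : ∀ (n : Fin ν → ℕ), mmv u' n (i + 1) = mmv u n (i + 1) - 1 := by
    intro n; simp only [mmv, huu]; ring
  have hmm2 : ∀ (n : Fin ν → ℕ) (k : Fin ν), k ≠ I → mmv u' n ((k : ℕ) + 1) = mmv u n ((k : ℕ) + 1) := by
    intro n k hk
    have : (k : ℕ) ≠ i := fun h' => hk (Fin.ext h')
    simp only [mmv]
    rw [huu2 _ (by omega)]
  set R : (Fin ν → ℕ) → F := fun n => q ^ EE w n *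
    ((q ^ (mmv u n (i + 1)) * qB q ((n I : ℤ) - 1 + mmv u n (i + 1)) ((n I : ℤ) - 1)) *
      ∏ k ∈ Finset.univ.erase I, qB q ((n k : ℤ) + mmv u n ((k : ℕ) + 1)) (n k)) with hR
  have hR0 : ∀ n : Fin ν → ℕ, n I = 0 → R n = 0 := by
    intro n hn
    have : qB q ((n I : ℤ) - 1 + mmv u n (i + 1)) ((n I : ℤ) - 1) = 0 := by
      unfold qB
      rw [if_neg]
      omega
    simp only [hR, this]
    ring
  have hsplit : ∀ n, TT q w u n = TT q w u' n + R n := by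
    intro n
    by_cases hbad : n I = 0 ∧ mmv u n (i + 1) = 0
    · obtain ⟨h1, h2⟩ := hbad
      have z2 : TT q w u' n = 0 := by
        apply TT_zero q w u' n (i + 1) (by omega) hjν
        rw [hmm, h2]; omega
      have z1 : TT q w u n = 0 := by
        have s1 := mmv_succ u n i
        have s2 := mmv_succ u n (i + 1)
        have s3 := NN_succ n I
        have s0 := mmv_zero u n
        simp only [hI] at s3 h1
        have e0 : u i = v i := by simp [hu, st]
        have e1 : u (i + 1) = v (i + 1) + 1 := by simp [hu, st]
        have e2 : u (i + 1 + 1) = v (i + 1 + 1) + 1 := by simp [hu, st]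
        have e00 : i = 0 → mmv u n i = 0 := by
          rintro rfl; rw [s0, e0, hv0]
        have e3 : i + 1 + 1 = i + 2 := rfl
        rw [← e3] at s3
        by_cases hlt : i + 1 < ν
        · have hc1 := hc hlt
          by_cases hneg : mmv u n (i + 1 + 1) < 0
          · exact TT_zero q w u n (i + 1 + 1) (by omega) (by omega) hneg
          · have hneg2 : mmv u n i < 0 := by
              omega
            have : i ≠ 0 := fun h => by have := e00 h; omega
            exact TT_zero q w u n i (by omega) (by omega) hneg2
        · have hc1 := hc' (by omega)
          have ht := NN_top n (i + 1 + 1) (by omega)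
          have hneg2 : mmv u n i < 0 := by
            omega
          have : i ≠ 0 := fun h => by have := e00 h; omega
          exact TT_zero q w u n i (by omega) (by omega) hneg2
      rw [z1, z2, hR0 n h1, add_zero]
    · have hp := qB_pascal q hq (n I) (mmv u n (i + 1)) hbad
      unfold TT
      rw [← Finset.mul_prod_erase Finset.univ _ (Finset.mem_univ I),
        ← Finset.mul_prod_erase Finset.univ (fun k : Fin ν => qB q ((n k : ℤ) + mmv u' n ((k : ℕ) + 1)) (n k))
          (Finset.mem_univ I)]
      have hprod : ∏ k ∈ Finset.univ.erase I, qB q ((n k : ℤ) + mmv u' n ((k : ℕ) + 1)) (n k)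
          = ∏ k ∈ Finset.univ.erase I, qB q ((n k : ℤ) + mmv u n ((k : ℕ) + 1)) (n k) := by
        apply Finset.prod_congr rfl
        intro k hk
        rw [hmm2 n k (Finset.ne_of_mem_erase hk)]
      rw [hprod]
      have hIv : (I : ℕ) = i := rfl
      simp only [hR, hIv, hmm]
      rw [hp]
      ring
  have hshift : ∀ n, R (φ n) = q ^ (v (i + 1) + 1 - ((i + 1 : ℕ) : ℤ) + ∑ l ∈ Finset.Icc 1 (i + 1), w l)
      * TT q w (fun x => u x - 2 * mn (i + 1) x) n := by
    intro n
    have hIv : (I : ℕ) = i := rfl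
    have hm1 : ∀ k, mmv u (φ n) k = mmv (fun x => u x - 2 * mn (i + 1) x) n k := fun k =>
      mmv_add u n I k
    have hE : EE w (φ n) = EE w n + ∑ l ∈ Finset.Icc 1 (i + 1), (2 * (NN n l : ℤ) + 1 + w l) :=
      EE_add w n I
    have hφI : ((φ n I : ℕ) : ℤ) - 1 = n I := by simp [hφ]
    have hφk : ∀ k ∈ Finset.univ.erase I, qB q (((φ n k : ℕ) : ℤ) + mmv u (φ n) ((k : ℕ) + 1)) (φ n k)
        = qB q ((n k : ℤ) + mmv (fun x => u x - 2 * mn (i + 1) x) n ((k : ℕ) + 1)) (n k) := by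
      intro k hk
      have : φ n k = n k := by
        simp [hφ, Finset.ne_of_mem_erase hk]
      rw [this, hm1]
    simp only [hR]
    rw [hφI, Finset.prod_congr rfl hφk, hm1, hE]
    unfold TT
    rw [← Finset.mul_prod_erase Finset.univ _ (Finset.mem_univ I)]
    simp only [hIv]
    have hexp : EE w n + ∑ l ∈ Finset.Icc 1 (i + 1), (2 * (NN n l : ℤ) + 1 + w l)
        + mmv (fun x => u x - 2 * mn (i + 1) x) n (i + 1)
        = (v (i + 1) + 1 - ((i + 1 : ℕ) : ℤ) + ∑ l ∈ Finset.Icc 1 (i + 1), w l) + EE w n := by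
      simp only [Finset.sum_add_distrib, ← Finset.mul_sum, mmv, hu, st, mn]
      simp
      ring
    have hpow := congrArg (fun z : ℤ => q ^ z) hexp
    rw [zpow_add₀ hq0 _ (mmv _ _ _), zpow_add₀ hq0 _ (EE w n)] at hpow
    linear_combination (qB q ((n I : ℤ) + mmv (fun x => u x - 2 * mn (i + 1) x) n (i + 1)) (n I) *
      ∏ k ∈ Finset.univ.erase I, qB q ((n k : ℤ) + mmv (fun x => u x - 2 * mn (i + 1) x) n ((k : ℕ) + 1)) (n k)) * hpow
  have hν : 1 ≤ ν := by omega
  have hf1 := TT_fin hν q w u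
  have hf2 := TT_fin hν q w u'
  have hRfin : (Function.support R).Finite := by
    apply Set.Finite.subset (hf1.union hf2)
    intro n hn
    rw [Function.mem_support] at hn
    by_contra hcon
    simp only [Set.mem_union, Function.mem_support, not_or, not_not] at hcon
    apply hn
    have := hsplit n
    rw [hcon.1, hcon.2] at this
    simpa using this.symm
  have hRsum : ∑ᶠ n, R n = ∑ᶠ n, R (φ n) := by
    rw [← finsum_mem_range (f := R) hφi, ← finsum_mem_univ R]
    apply finsum_mem_inter_support_eq
    ext n
    simp only [Set.mem_inter_iff, Set.mem_univ, true_and, Function.mem_support, Set.mem_range]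
    constructor
    · intro h
      refine ⟨⟨n - Pi.single I 1, ?_⟩, h⟩
      have : n I ≠ 0 := fun h' => h (hR0 n h')
      funext k
      by_cases hk : k = I
      · subst hk; simp [hφ]; omega
      · simp [hφ, hk]
    · exact fun h => h.2
  unfold SS
  rw [finsum_congr hsplit, finsum_add_distrib hf2 hRfin, hRsum, finsum_congr hshift, ← mul_finsum]

theorem SS_tele {F : Type*} [Field F] (ν : ℕ) (q : F) (hq0 : q ≠ 0)
    (hq : ∀ j : ℕ, q ^ (j + 1) ≠ 1) (w v : ℕ → ℤ) (hv0 : v 0 = 0) (c : ℕ) (hc1 : 1 ≤ c) (p : ℕ)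
    (hcp : c ≤ p) (hp : p ≤ ν + 1)
    (hc : ∀ j, c ≤ j → j < p → j < ν → v (j + 1) - 2 * v j + v (j - 1) ≤ 0)
    (hc' : p = ν + 1 → v (ν - 1) ≤ v ν) :
    SS ν q w (fun x => v x + st c x) = SS ν q w (fun x => v x + st p x)
      + ∑ j ∈ Finset.Ico c p, q ^ (v j + 1 - j + ∑ l ∈ Finset.Icc 1 j, w l)
        * SS ν q w (fun x => v x + st j x - 2 * mn j x) := by
  induction p, hcp using Nat.le_induction with
  | base => simp
  | succ p hcp ih =>
    rw [ih (by omega) (fun j h1 h2 h3 => hc j h1 (by omega) h3) (fun h => by omega),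
      Finset.sum_Ico_succ_top hcp,
      SS_rec ν q hq0 hq w v hv0 p (by omega) (by omega) (fun h => hc p hcp (by omega) h)
        (fun h => by subst h; exact hc' rfl)]
    ring

theorem SS_claim {F : Type*} [Field F] (ν : ℕ) (q : F) (hq0 : q ≠ 0)
    (hq : ∀ j : ℕ, q ^ (j + 1) ≠ 1) (w : ℕ → ℤ) (p : ℕ) (hp : p ≤ ν) :
    ∀ (b : ℕ) (_ : 1 ≤ b) (_ : b ≤ p) (y : ℕ → ℤ) (H : ℤ) (_ : y 0 = 0)
      (_ : ∀ j, 1 ≤ j → j < p → y (j + 1) - 2 * y j + y (j - 1) ≤ 0)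
      (_ : ∀ j, j ≤ p → y j + ∑ l ∈ Finset.Icc 1 j, w l = H * j),
    ∑ j ∈ Finset.Ico b (p + 1), q ^ (H * j + b - j) *
        SS ν q w (fun x => y x + mn (b - 1) x + st j x - 2 * mn j x)
      = q ^ (H * b) * SS ν q w (fun x => y x + mn (p - b) x - mn p x) := by
  induction p with
  | zero => intro b h1 h2; omega
  | succ p ih =>
    intro b hb1 hbp y H hy0 hconc hH
    rcases Nat.lt_or_ge b (p + 1) with hlt | hge
    · -- b ≤ p
      have ih1 := ih (by omega) b hb1 (by omega) y H hy0 (fun j h1 h2 => hconc j h1 (by omega))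
        (fun j h => hH j (by omega))
      have ih2 := ih (by omega) (p + 1 - b) (by omega) (by omega) (fun x => y x - mn (p + 1) x) (H - 1)
        (by simp [hy0, mn]; omega)
        (fun j h1 h2 => by
          have := hconc j h1 (by omega)
          simp only [mn]
          omega)
        (fun j h => by
          have := hH j (by omega)
          have e : mn (p + 1) j = j := by simp only [mn]; omega
          rw [e]
          linear_combination this)
      have tl := SS_tele ν q hq0 hq w (fun x => y x + mn (p + 1 - b - 1) x - mn (p + 1) x)
        (by simp only [hy0, mn]; omega) (p + 1 - b) (by omega) (p + 1) (by omega) (by omega)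
        (fun j h1 h2 h3 => by
          have := hconc j (by omega) (by omega)
          simp only [mn]
          omega)
        (fun h => by omega)
      have c1 : SS ν q w (fun x => y x + mn (p + 1 - b - 1) x - mn (p + 1) x + st (p + 1 - b) x)
          = SS ν q w (fun x => y x + mn (p + 1 - b) x - mn (p + 1) x) := by
        apply SS_congr
        intro k _ _
        simp only [mn, st]
        split_ifs <;> omega
      have c2 : SS ν q w (fun x => y x + mn (p + 1 - b - 1) x - mn (p + 1) x + st (p + 1) x)
          = SS ν q w (fun x => y x + mn (p - b) x - mn p x) := by
        apply SS_congr
        intro k _ _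
        simp only [mn, st]
        split_ifs <;> omega
      have c3 : ∑ j ∈ Finset.Ico (p + 1 - b) (p + 1),
          q ^ (y j + mn (p + 1 - b - 1) j - mn (p + 1) j + 1 - (j : ℤ) + ∑ l ∈ Finset.Icc 1 j, w l) *
          SS ν q w (fun x => y x + mn (p + 1 - b - 1) x - mn (p + 1) x + st j x - 2 * mn j x)
          = q ^ ((H - 1) * ((p + 1 - b : ℕ) : ℤ)) *
            SS ν q w (fun x => y x + mn (b - 1) x + st (p + 1) x - 2 * mn (p + 1) x) := by
        have c4 : SS ν q w (fun x => y x - mn (p + 1) x + mn (p - (p + 1 - b)) x - mn p x)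
            = SS ν q w (fun x => y x + mn (b - 1) x + st (p + 1) x - 2 * mn (p + 1) x) := by
          apply SS_congr
          intro k _ _
          simp only [mn, st]
          split_ifs <;> omega
        rw [← c4, ← ih2]
        apply Finset.sum_congr rfl
        intro j hj
        rw [Finset.mem_Ico] at hj
        have hHj := hH j (by omega)
        congr 1
        · congr 1
          have e : mn (p + 1) j = j := by simp only [mn]; omega
          have e' : mn (p + 1 - b - 1) j = ((p + 1 - b : ℕ) : ℤ) - 1 := by simp only [mn]; omega
          rw [e, e']
          linear_combination hHj
        · apply SS_congr
          intro k _ _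
          ring
      rw [c1, c2, c3] at tl
      rw [Finset.sum_Ico_succ_top (by omega), ih1, tl, mul_add, ← mul_assoc (q ^ (H * (b : ℤ))),
        ← zpow_add₀ hq0]
      congr 3
      push_cast [Nat.cast_sub (show b ≤ p + 1 by omega)]
      ring
    · have hb : b = p + 1 := by omega
      subst hb
      rw [Nat.Ico_succ_singleton, Finset.sum_singleton]
      congr 1
      · congr 1; ring
      · apply SS_congr
        intro k _ _
        simp only [mn, st]
        split_ifs <;> omega

/-- the weights `w` for given `s`, `M`. -/
def wv (s M : ℕ) (l : ℕ) : ℤ := (if s < l then 1 else 0) - M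

theorem wv_sum (s M j : ℕ) : ∑ l ∈ Finset.Icc 1 j, wv s M l = j - mn s j - M * j := by
  induction j with
  | zero => simp [mn]
  | succ j ih =>
    rw [Finset.sum_Icc_succ_top (by omega), ih]
    simp only [wv, mn]
    have : (M : ℤ) * ((j + 1 : ℕ) : ℤ) = M * j + M := by push_cast; ring
    rw [this]
    split_ifs <;> omega

theorem FpolyM_eq {F : Type*} [Field F] (ν s b L M : ℕ) (q : F) :
    FpolyM ν s b L M q
      = SS ν q (wv s M) (fun x => (x : ℤ) * ((L : ℤ) - 2) + mn s x + mn b x) := by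
  unfold FpolyM SS
  apply finsum_congr
  intro n
  unfold TT
  congr 1
  · congr 1
    unfold expAG EE
    have : ∑ i ∈ Finset.Icc (s + 1) ν, NN n i = ∑ i ∈ Finset.Icc 1 ν, if s < i then NN n i else 0 := by
      rw [← Finset.sum_filter]
      congr 1
      ext l
      simp
      omega
    rw [this]
    push_cast
    rw [Finset.mul_sum, ← Finset.sum_add_distrib, ← Finset.sum_sub_distrib]
    apply Finset.sum_congr rfl
    intro l _
    unfold wv
    split_ifs <;> ring
  · apply Finset.prod_congr rfl
    intro i _
    congr 1
    have h : ∀ t : ℕ, alph ((i : ℕ) + 1) t = ((i : ℕ) + 1 : ℤ) - mn t ((i : ℕ) + 1) := by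
      intro t; simp only [alph, mn]; omega
    rw [h, h]
    unfold mmv
    push_cast
    ring

theorem F_rec0 {F : Type*} [Field F] (ν s L M : ℕ) (q : F) :
    FpolyM ν s 0 (L + 1) M q = FpolyM ν s ν L M q := by
  rw [FpolyM_eq, FpolyM_eq]
  apply SS_congr
  intro k h1 h2
  have e1 : mn 0 k = 0 := by simp only [mn]; omega
  have e2 : mn ν k = k := by simp only [mn]; omega
  rw [e1, e2]
  push_cast
  ring

theorem F_rec {F : Type*} [Field F] (ν s L M : ℕ) (q : F) (hq0 : q ≠ 0)
    (hq : ∀ j : ℕ, q ^ (j + 1) ≠ 1) (hL : 1 ≤ L) (b : ℕ) (hb : b + 1 ≤ ν) :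
    FpolyM ν s (b + 1) (L + 1) M q = FpolyM ν s b (L + 1) M q
      + q ^ (((L : ℤ) - M) * (b + 1 : ℕ)) * FpolyM ν s (ν - (b + 1)) L M q := by
  rw [FpolyM_eq, FpolyM_eq, FpolyM_eq]
  set y : ℕ → ℤ := fun x => (x : ℤ) * (((L + 1 : ℕ) : ℤ) - 2) + mn s x with hy
  obtain ⟨d, hd⟩ : ∃ d : ℕ, ((L + 1 : ℕ) : ℤ) - 2 = d := ⟨L - 1, by omega⟩
  have hconc : ∀ j, 1 ≤ j → y (j + 1) - 2 * y j + y (j - 1) ≤ 0 := by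
    intro j hj
    have : y (j + 1) - 2 * y j + y (j - 1) = mn s (j + 1) - 2 * mn s j + mn s (j - 1) := by
      simp only [hy]
      push_cast [Nat.cast_sub hj]
      ring
    rw [this]
    simp only [mn]
    omega
  have hy0 : y 0 = 0 := by simp [hy, mn]
  have tl := SS_tele ν q hq0 hq (wv s M) (fun x => y x + mn b x) (by simp [hy0, mn]) (b + 1) (by omega)
    (ν + 1) (by omega) le_rfl
    (fun j h1 h2 h3 => by
      have := hconc j (by omega)
      simp only [mn]
      omega)
    (fun _ => by
      have : (((ν - 1 : ℕ) : ℤ)) * (d : ℤ) ≤ (ν : ℤ) * d := by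
        apply mul_le_mul_of_nonneg_right <;> omega
      simp only [hy, hd, mn]
      omega)
  have hHy : ∀ j, y j + ∑ l ∈ Finset.Icc 1 j, wv s M l = ((L : ℤ) - M) * j := by
    intro j
    rw [wv_sum]
    simp only [hy]
    push_cast
    ring
  have cl := SS_claim ν q hq0 hq (wv s M) ν le_rfl (b + 1) (by omega) hb y ((L : ℤ) - M) hy0
    (fun j h1 _ => hconc j h1) (fun j _ => hHy j)
  have c1 : SS ν q (wv s M) (fun x => y x + mn b x + st (b + 1) x)
      = SS ν q (wv s M) (fun x => y x + mn (b + 1) x) := by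
    apply SS_congr
    intro k _ _
    simp only [mn, st]
    split_ifs <;> omega
  have c2 : SS ν q (wv s M) (fun x => y x + mn b x + st (ν + 1) x)
      = SS ν q (wv s M) (fun x => y x + mn b x) := by
    apply SS_congr
    intro k _ _
    simp only [mn, st]
    split_ifs <;> omega
  have c3 : SS ν q (wv s M) (fun x => y x + mn (ν - (b + 1)) x - mn ν x)
      = SS ν q (wv s M) (fun x => (x : ℤ) * ((L : ℤ) - 2) + mn s x + mn (ν - (b + 1)) x) := by
    apply SS_congr
    intro k _ _
    have e2 : mn ν k = k := by simp only [mn]; omega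
    simp only [e2, hy]
    push_cast
    ring
  rw [c1, c2] at tl
  rw [c3] at cl
  rw [tl, ← cl]
  congr 1
  apply Finset.sum_congr rfl
  intro j hj
  rw [Finset.mem_Ico] at hj
  congr 1
  congr 1
  have e : mn b j = b := by simp only [mn]; omega
  have := hHy j
  rw [e]
  push_cast
  linear_combination this

theorem F_base {F : Type*} [Field F] (ν s b M : ℕ) (q : F) (hν : 1 ≤ ν)
    (hq : ∀ j : ℕ, q ^ (j + 1) ≠ 1) (hs : s ≤ ν) (hb : b ≤ ν) :
    FpolyM ν s b 1 M q = if ν ≤ s + b then 1 else 0 := by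
  rw [FpolyM_eq]
  unfold SS
  rw [finsum_eq_single _ 0]
  · have hN : ∀ l, NN (0 : Fin ν → ℕ) l = 0 := by intro l; simp [NN]
    split_ifs with h
    · unfold TT
      rw [Finset.prod_eq_one]
      · simp [EE, hN]
      · intro i _
        simp only [Pi.zero_apply, Nat.cast_zero, zero_add]
        apply qB_zero_right q hq
        simp only [mmv, hN, mn]
        simp
        omega
    · apply TT_zero q _ _ _ ν hν le_rfl
      simp only [mmv, hN, mn]
      simp
      omega
  · intro n hn
    apply TT_zero q _ _ _ 1 le_rfl hν
    obtain ⟨i, hi⟩ := Function.ne_iff.mp hn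
    have := NN_le n i
    simp only [Pi.zero_apply] at hi
    simp only [mmv, Finset.Icc_self, Finset.sum_singleton, mn]
    omega

/-! ### Gordon side -/

/-- Gordon sums indexed by length. -/
def GG {F : Type*} [Field F] (ν M s n b : ℕ) (q : F) : F :=
  ∑ᶠ f ∈ {f : ℕ → ℕ | IsGordon ν n s b f}, q ^ gwt (-(M : ℤ)) n f

theorem G_eq_GG {F : Type*} [Field F] (ν M s n b : ℕ) (q : F) :
    G ν (-(M : ℤ)) ((n : ℤ) - M) s b q = GG ν M s n b q := by
  unfold G GG
  have : ((n : ℤ) - M - -(M : ℤ)).toNat = n := by omega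
  rw [this]
  apply finsum_congr
  intro f
  rw [finsum_eq_if]
  rfl

theorem gordon_succ (ν s n b : ℕ) (hb : b ≤ ν) :
    {f : ℕ → ℕ | IsGordon ν (n + 1) s b f} =
      ⋃ c ∈ Set.Iic (ν - b), Set.image (fun f => Function.update f (n + 1) b) {f : ℕ → ℕ | IsGordon ν n s c f} := by
  ext f
  simp only [Set.mem_setOf_eq, Set.mem_iUnion, Set.mem_Iic, Set.mem_image, exists_prop]
  constructor
  · rintro ⟨h0, h1, h2, h3⟩
    have hn := h2 n (by omega)
    refine ⟨f n, by omega, Function.update f (n + 1) 0, ⟨?_, ?_, ?_, ?_⟩, ?_⟩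
    · rw [Function.update_of_ne (by omega)]; exact h0
    · rw [Function.update_of_ne (by omega)]
    · intro k hk
      rw [Function.update_of_ne (by omega), Function.update_of_ne (by omega)]
      exact h2 k (by omega)
    · intro k hk
      by_cases hk' : k = n + 1
      · subst hk'; simp
      · rw [Function.update_of_ne hk']; exact h3 k (by omega)
    · rw [Function.update_idem, ← h1, Function.update_eq_self]
  · rintro ⟨c, hc, g, ⟨h0, h1, h2, h3⟩, rfl⟩
    refine ⟨?_, ?_, ?_, ?_⟩
    · rw [Function.update_of_ne (by omega)]; exact h0
    · simp
    · intro k hk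
      rw [Function.update_of_ne (by omega)]
      by_cases hk' : k = n
      · subst hk'; simp; omega
      · rw [Function.update_of_ne (by omega)]; exact h2 k (by omega)
    · intro k hk
      rw [Function.update_of_ne (by omega)]; exact h3 k (by omega)

theorem gordon_fin (ν s n : ℕ) : ∀ b, {f : ℕ → ℕ | IsGordon ν n s b f}.Finite := by
  induction n with
  | zero =>
    intro b
    apply Set.Finite.subset (Set.finite_singleton (Function.update (fun _ => 0) 0 s : ℕ → ℕ))
    rintro f ⟨h0, h1, h2, h3⟩
    rw [Set.mem_singleton_iff]
    funext k
    by_cases hk : k = 0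
    · subst hk; simpa using h0
    · rw [Function.update_of_ne hk]; exact h3 k (by omega)
  | succ n ih =>
    intro b
    by_cases hb : b ≤ ν
    · rw [gordon_succ ν s n b hb]
      exact (Set.finite_Iic _).biUnion (fun c _ => (ih c).image _)
    · convert Set.finite_empty
      ext f
      simp only [Set.mem_setOf_eq, Set.mem_empty_iff_false, iff_false]
      rintro ⟨h0, h1, h2, h3⟩
      have := h2 n (by omega)
      omega

theorem GG_succ {F : Type*} [Field F] (ν M s n b : ℕ) (q : F) (hq0 : q ≠ 0) (hn : 1 ≤ n) (hb : b ≤ ν) :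
    GG ν M s (n + 1) b q
      = ∑ c ∈ Finset.range (ν - b + 1), q ^ (((n : ℤ) - M) * c) * GG ν M s n c q := by
  have hinj : ∀ c, Set.InjOn (fun f : ℕ → ℕ => Function.update f (n + 1) b) {f : ℕ → ℕ | IsGordon ν n s c f} := by
    rintro c f ⟨_, _, _, h3⟩ g ⟨_, _, _, h3'⟩ hfg
    funext k
    by_cases hk : k = n + 1
    · subst hk; rw [h3 _ (by omega), h3' _ (by omega)]
    · have := congrFun hfg k
      simpa [hk] using this
  unfold GG
  rw [gordon_succ ν s n b hb, finsum_mem_biUnion]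
  · have hI : Set.Iic (ν - b) = ((Finset.range (ν - b + 1) : Finset ℕ) : Set ℕ) := by
      ext c; simp
    rw [hI, finsum_mem_coe_finset]
    apply Finset.sum_congr rfl
    intro c _
    rw [finsum_mem_image (hinj c), mul_finsum_mem]
    apply finsum_mem_congr rfl
    rintro f ⟨h0, h1, h2, h3⟩
    rw [← zpow_add₀ hq0]
    congr 1
    unfold gwt
    have : Finset.Ioo 0 (n + 1) = insert n (Finset.Ioo 0 n) := by
      ext k; simp; omega
    rw [this, Finset.sum_insert (by simp)]
    congr 1
    · rw [Function.update_of_ne (by omega), h1]; ring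
    · apply Finset.sum_congr rfl
      intro k hk
      rw [Finset.mem_Ioo] at hk
      rw [Function.update_of_ne (by omega)]
  · intro c _ c' _ hcc
    rw [Function.onFun, Set.disjoint_left]
    rintro _ ⟨f, hf, rfl⟩ ⟨g, hg, hgf⟩
    apply hcc
    have := congrFun hgf n
    simp only [Function.update_of_ne (show n ≠ n + 1 by omega)] at this
    rw [← hf.2.1, ← hg.2.1, this]
  · exact Set.finite_Iic _
  · intro c _
    exact (gordon_fin ν s n c).image _

theorem GG_one {F : Type*} [Field F] (ν M s b : ℕ) (q : F) :
    GG ν M s 1 b q = if s + b ≤ ν then 1 else 0 := by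
  unfold GG
  split_ifs with h
  · have : {f : ℕ → ℕ | IsGordon ν 1 s b f} = {fun k => if k = 0 then s else if k = 1 then b else 0} := by
      ext f
      simp only [Set.mem_setOf_eq, Set.mem_singleton_iff]
      constructor
      · rintro ⟨h0, h1, h2, h3⟩
        funext k
        split_ifs with hk hk'
        · subst hk; exact h0
        · subst hk'; exact h1
        · exact h3 k (by omega)
      · rintro rfl
        refine ⟨by simp, by simp, ?_, ?_⟩
        · intro k hk
          have : k = 0 := by omega
          subst this
          simpa using h
        · intro k hk
          show (if k = 0 then s else if k = 1 then b else 0) = 0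
          rw [if_neg (by omega), if_neg (by omega)]
    rw [this, finsum_mem_singleton]
    have he : Finset.Ioo 0 1 = (∅ : Finset ℕ) := by
      ext k; simp; omega
    simp [gwt, he]
  · have : {f : ℕ → ℕ | IsGordon ν 1 s b f} = ∅ := by
      ext f
      simp only [Set.mem_setOf_eq, Set.mem_empty_iff_false, iff_false]
      rintro ⟨h0, h1, h2, h3⟩
      have := h2 0 (by omega)
      simp only [zero_add] at this
      omega
    rw [this, finsum_mem_empty]

theorem main_id {F : Type*} [Field F] (ν s M : ℕ) (q : F) (hq0 : q ≠ 0)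
    (hq : ∀ j : ℕ, q ^ (j + 1) ≠ 1) (hν : 1 ≤ ν) (hs : s ≤ ν) (L : ℕ) (hL : 1 ≤ L) :
    ∀ b, b ≤ ν → FpolyM ν s b L M q = GG ν M (ν - s) L (ν - b) q := by
  induction L, hL using Nat.le_induction with
  | base =>
    intro b hb
    rw [F_base ν s b M q hν hq hs hb, GG_one]
    congr 1
    apply propext
    omega
  | succ L hL ih =>
    intro b
    induction b with
    | zero =>
      intro _
      rw [F_rec0, ih ν le_rfl, GG_succ ν M _ L _ q hq0 hL (by omega)]
      simp
    | succ b ihb =>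
      intro hb
      rw [F_rec ν s L M q hq0 hq hL b hb, ihb (by omega), ih _ (by omega),
        GG_succ ν M _ L _ q hq0 hL (by omega), GG_succ ν M _ L _ q hq0 hL (by omega)]
      have e1 : ν - (ν - (b + 1)) + 1 = b + 1 + 1 := by omega
      have e2 : ν - (ν - b) + 1 = b + 1 := by omega
      have e3 : ν - (ν - (b + 1)) = b + 1 := by omega
      rw [e1, e2, e3, Finset.sum_range_succ _ (b + 1)]

theorem ratfunc_X_pow (j : ℕ) : (RatFunc.X : K) ^ (j + 1) ≠ 1 := by
  intro h
  have h2 : algebraMap (Polynomial ℚ) (RatFunc ℚ) (Polynomial.X ^ (j + 1))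
      = algebraMap (Polynomial ℚ) (RatFunc ℚ) 1 := by
    rw [map_pow, map_one, RatFunc.algebraMap_X]
    exact h
  have h3 := RatFunc.algebraMap_injective ℚ h2
  have := congrArg Polynomial.natDegree h3
  simp at this

theorem stmt_15 (ν : ℕ) (hν : 1 ≤ ν) (s b : ℕ) (hs : s ≤ ν) (hb : b ≤ ν)
    (L : ℕ) (hL : 2 ≤ L) (M : ℕ) (hM : M ≤ L) :
    FpolyM ν s b L M (RatFunc.X : K) =
      G ν (-(M : ℤ)) ((L : ℤ) - M) (ν - s) (ν - b) RatFunc.X := by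
  have h : G ν (-(M : ℤ)) ((L : ℤ) - M) (ν - s) (ν - b) (RatFunc.X : K)
      = GG ν M (ν - s) L (ν - b) RatFunc.X := G_eq_GG ν M (ν - s) L (ν - b) RatFunc.X
  rw [h]
  exact main_id ν s M RatFunc.X RatFunc.X_ne_zero ratfunc_X_pow hν hs L (by omega) b hb


end
end

section
/- For all integers ν ≥ 1, 0 ≤ s, b ≤ ν, L ≥ 2, and 0 ≤ M ≤ L, the following identity of Laurent polynomials in q holds: Σ over tuples n = (n_1,…,n_ν) of nonnegative integers of q^{N_1²+⋯+N_ν²+N_{s+1}+⋯+N_ν−M(N_1+⋯+N_ν)} ∏_{i=1}^ν [n_i + iL − 2Σ_{l=1}^i N_l − α_{i,s} − α_{i,b} choose n_i]_q = Σ_{s'=0}^ν G^ν_{0,M}(s',ν−s,1/q) · G^ν_{0,L−M}(s',ν−b,q). -/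
open scoped Classical

noncomputable section

/-! ### The proof: fermionic side -/

namespace AG

lemma X_pow_ne (j : ℕ) : (1 : K) - RatFunc.X ^ (j + 1) ≠ 0 := by
  intro h
  have h1 : (RatFunc.X : K) ^ (j + 1) = 1 := (sub_eq_zero.mp h).symm
  have h2 : algebraMap (Polynomial ℚ) K (Polynomial.X ^ (j + 1)) =
      algebraMap (Polynomial ℚ) K 1 := by
    rw [map_pow, RatFunc.algebraMap_X, h1, map_one]
  have h3 := RatFunc.algebraMap_injective ℚ h2
  have h4 := congrArg Polynomial.natDegree h3
  simp at h4

lemma qP_ne (n : ℕ) : qP (RatFunc.X : K) n ≠ 0 :=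
  Finset.prod_ne_zero_iff.mpr fun j _ => X_pow_ne j

lemma qP_succ (n : ℕ) : qP (RatFunc.X : K) (n + 1) = qP RatFunc.X n * (1 - RatFunc.X ^ (n + 1)) := by
  simp [qP, Finset.prod_range_succ]

lemma qB_nat (n m : ℕ) : qB (RatFunc.X : K) ((n : ℤ) + m) n =
    qP RatFunc.X (n + m) / (qP RatFunc.X n * qP RatFunc.X m) := by
  unfold qB
  rw [if_pos (by omega)]
  congr 2 <;> congr 1 <;> omega

lemma qB_neg (n : ℤ) (m : ℤ) (h : m < 0) : qB (RatFunc.X : K) (n + m) n = 0 := by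
  unfold qB
  rw [if_neg (by omega)]

lemma qB_zero (m : ℕ) : qB (RatFunc.X : K) m 0 = 1 := by
  have := qB_nat 0 m
  simp only [Nat.cast_zero, zero_add] at this
  rw [this]
  have h0 : qP (RatFunc.X : K) 0 = 1 := by simp [qP]
  rw [h0, one_mul, div_self (qP_ne m)]

lemma qB_pascal (n : ℕ) (m : ℤ) (h : ¬ (n = 0 ∧ m = 0)) :
    qB (RatFunc.X : K) (n + m) n =
      RatFunc.X ^ (n : ℤ) * qB RatFunc.X (n + (m - 1)) n + qB RatFunc.X (n + (m - 1)) (n - 1) := by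
  rcases lt_or_ge m 0 with hm | hm
  · rw [qB_neg _ _ hm, qB_neg _ _ (by omega)]
    have : (n : ℤ) + (m - 1) = (n - 1 : ℤ) + m := by ring
    rw [this, qB_neg _ _ hm]; simp
  obtain ⟨m, rfl⟩ := Int.eq_ofNat_of_zero_le hm
  rcases n with _ | n
  · obtain ⟨m, rfl⟩ : ∃ k, m = k + 1 := ⟨m - 1, by omega⟩
    have e1 := qB_zero (m + 1)
    have e2 := qB_zero m
    have e3 : qB (RatFunc.X : K) (((0 : ℕ) : ℤ) + (((m + 1 : ℕ) : ℤ) - 1)) (((0 : ℕ) : ℤ) - 1) = 0 := by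
      unfold qB; rw [if_neg (by omega)]
    rw [e3]
    push_cast at e1 e2 ⊢
    simp [e1, e2]
  · have e3 : qB (RatFunc.X : K) (((n + 1 : ℕ) : ℤ) + ((m : ℤ) - 1)) (((n + 1 : ℕ) : ℤ) - 1) =
        qP RatFunc.X (n + m) / (qP RatFunc.X n * qP RatFunc.X m) := by
      rw [← qB_nat]; congr 1 <;> push_cast <;> ring
    rw [e3]
    have e1 := qB_nat (n + 1) m
    rw [e1]
    rcases m with _ | m
    · have e2 : qB (RatFunc.X : K) (((n + 1 : ℕ) : ℤ) + (((0 : ℕ) : ℤ) - 1)) ((n + 1 : ℕ) : ℤ) = 0 :=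
        qB_neg _ _ (by simp)
      rw [e2]
      have h0 : qP (RatFunc.X : K) 0 = 1 := by simp [qP]
      have := qP_ne n
      have := qP_ne (n + 1)
      simp only [add_zero, h0, mul_one, mul_zero, zero_add]
      rw [div_self this, div_self (qP_ne n)]
    · have e2 : qB (RatFunc.X : K) (((n + 1 : ℕ) : ℤ) + (((m + 1 : ℕ) : ℤ) - 1)) ((n + 1 : ℕ) : ℤ) =
          qP RatFunc.X (n + 1 + m) / (qP RatFunc.X (n + 1) * qP RatFunc.X m) := by
        rw [← qB_nat]; congr 1; push_cast; ring
      rw [e2]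
      have a1 : qP (RatFunc.X : K) (n + 1 + (m + 1)) =
          qP RatFunc.X (n + m + 1) * (1 - RatFunc.X ^ (n + m + 2)) := by
        rw [show n + 1 + (m + 1) = (n + m + 1) + 1 by ring, qP_succ]
      have a2 : n + 1 + m = n + m + 1 := by ring
      have a3 : n + (m + 1) = n + m + 1 := by ring
      rw [a1, a2, a3, qP_succ n, qP_succ m, zpow_natCast]
      have b1 := qP_ne n
      have b2 := qP_ne m
      have b3 := X_pow_ne n
      have b4 := X_pow_ne m
      field_simp
      ring

variable {ν : ℕ}

/-- The quantity `m_i`. -/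
def mm (a : ℕ → ℤ) (L : ℤ) (n : Fin ν → ℕ) (i : ℕ) : ℤ :=
  i * L - 2 * (∑ l ∈ Finset.Icc 1 i, (NN n l : ℤ)) - a i

/-- The exponent of `q`. -/
def ex (c : ℕ → ℤ) (n : Fin ν → ℕ) : ℤ :=
  ∑ i ∈ Finset.Icc 1 ν, ((NN n i : ℤ)) ^ 2 + ∑ k : Fin ν, c ((k : ℕ) + 1) * n k

/-- The summand of the generalized fermionic sum. -/
def TT (a c : ℕ → ℤ) (L : ℤ) (n : Fin ν → ℕ) : K :=
  RatFunc.X ^ ex c n * ∏ i : Fin ν, qB RatFunc.X ((n i : ℤ) + mm a L n ((i : ℕ) + 1)) (n i)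

/-- The generalized fermionic sum. -/
def FF (ν : ℕ) (a c : ℕ → ℤ) (L : ℤ) : K := ∑ᶠ n : Fin ν → ℕ, TT a c L n

lemma prod_zero (a : ℕ → ℤ) (L : ℤ) (n : Fin ν → ℕ) (i : ℕ) (h1 : 1 ≤ i) (h2 : i ≤ ν)
    (h : mm a L n i < 0) :
    ∏ i : Fin ν, qB (RatFunc.X : K) ((n i : ℤ) + mm a L n ((i : ℕ) + 1)) (n i) = 0 := by
  apply Finset.prod_eq_zero (Finset.mem_univ (⟨i - 1, by omega⟩ : Fin ν))
  apply qB_neg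
  simp only
  rwa [Nat.sub_add_cancel h1]

lemma le_NN_one (n : Fin ν → ℕ) (k : Fin ν) : n k ≤ NN n 1 := by
  unfold NN
  have := Finset.single_le_sum (f := fun k : Fin ν => if 1 ≤ (k : ℕ) + 1 then n k else 0)
    (fun _ _ => Nat.zero_le _) (Finset.mem_univ k)
  simpa using this

lemma supp_bound (hν : 1 ≤ ν) (a : ℕ → ℤ) (L : ℤ) (n : Fin ν → ℕ)
    (h : ∏ i : Fin ν, qB (RatFunc.X : K) ((n i : ℤ) + mm a L n ((i : ℕ) + 1)) (n i) ≠ 0) :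
    2 * (NN n 1 : ℤ) ≤ L - a 1 := by
  by_contra hc
  apply h
  apply prod_zero a L n 1 le_rfl hν
  unfold mm
  simp only [Finset.Icc_self, Finset.sum_singleton]
  push_cast
  linarith

lemma TT_finite (hν : 1 ≤ ν) (a c : ℕ → ℤ) (L : ℤ) :
    (Function.support (TT (ν := ν) a c L)).Finite := by
  apply (Set.finite_Iic (fun _ : Fin ν => (L - a 1).toNat)).subset
  intro n hn k
  have h1 := supp_bound hν a L n (right_ne_zero_of_mul hn)
  have h2 := le_NN_one n k
  simp only
  omega

/-- The unit vector. -/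
def bump (n : Fin ν → ℕ) (i : Fin ν) : Fin ν → ℕ := fun k => n k + if k = i then 1 else 0

lemma NN_bump (n : Fin ν → ℕ) (i : Fin ν) (l : ℕ) :
    NN (bump n i) l = NN n l + if l ≤ (i : ℕ) + 1 then 1 else 0 := by
  unfold NN bump
  have : ∀ k : Fin ν, (if l ≤ (k : ℕ) + 1 then n k + (if k = i then 1 else 0) else 0) =
      (if l ≤ (k : ℕ) + 1 then n k else 0) + if k = i then (if l ≤ (i : ℕ) + 1 then 1 else 0) else 0 := by
    intro k
    by_cases hk : k = i
    · subst hk; split_ifs <;> simp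
    · simp [hk]
  simp only [this, Finset.sum_add_distrib, Finset.sum_ite_eq', Finset.mem_univ, if_true]

lemma NN_succ (n : Fin ν → ℕ) (i : Fin ν) : NN n ((i : ℕ) + 1) = n i + NN n ((i : ℕ) + 2) := by
  unfold NN
  have : ∀ k : Fin ν, (if (i : ℕ) + 1 ≤ (k : ℕ) + 1 then n k else 0) =
      (if k = i then n i else 0) + if (i : ℕ) + 2 ≤ (k : ℕ) + 1 then n k else 0 := by
    intro k
    by_cases hk : k = i
    · subst hk; simp
    · have : (k : ℕ) ≠ i := fun h => hk (Fin.ext h)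
      simp only [hk, if_false, zero_add]
      congr 1
      simp only [eq_iff_iff]; omega
  simp only [this, Finset.sum_add_distrib, Finset.sum_ite_eq', Finset.mem_univ, if_true]

lemma NN_top (n : Fin ν → ℕ) (l : ℕ) (h : ν < l) : NN n l = 0 := by
  unfold NN
  apply Finset.sum_eq_zero
  intro k _
  rw [if_neg (by omega)]

lemma sum_Icc_ite (p i : ℕ) : (∑ l ∈ Finset.Icc 1 i, if l ≤ p then (1 : ℤ) else 0) = min (i : ℤ) p := by
  induction i with
  | zero => simp
  | succ i ih =>
    rw [Finset.sum_Icc_succ_top (by omega), ih]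
    split_ifs <;> push_cast <;> omega

lemma sumNN_bump (n : Fin ν → ℕ) (p : Fin ν) (i : ℕ) :
    ∑ l ∈ Finset.Icc 1 i, (NN (bump n p) l : ℤ) =
      ∑ l ∈ Finset.Icc 1 i, (NN n l : ℤ) + min (i : ℤ) ((p : ℕ) + 1 : ℤ) := by
  have := sum_Icc_ite ((p : ℕ) + 1) i
  push_cast at this
  rw [← this, ← Finset.sum_add_distrib]
  apply Finset.sum_congr rfl
  intro l _
  rw [NN_bump]; push_cast; rfl

lemma sumNN (n : Fin ν → ℕ) (i : ℕ) :
    ∑ l ∈ Finset.Icc 1 i, (NN n l : ℤ) = ∑ k : Fin ν, min (i : ℤ) ((k : ℕ) + 1 : ℤ) * n k := by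
  unfold NN
  push_cast
  rw [Finset.sum_comm]
  apply Finset.sum_congr rfl
  intro k _
  have := sum_Icc_ite ((k : ℕ) + 1) i
  push_cast at this
  rw [← this, Finset.sum_mul]
  apply Finset.sum_congr rfl
  intro l _
  split_ifs <;> simp

lemma sum_bump (c : ℕ → ℤ) (n : Fin ν → ℕ) (p : Fin ν) :
    ∑ k : Fin ν, c ((k : ℕ) + 1) * (bump n p k : ℤ) =
      ∑ k : Fin ν, c ((k : ℕ) + 1) * n k + c ((p : ℕ) + 1) := by
  unfold bump
  push_cast
  simp [mul_add, Finset.sum_add_distrib]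

lemma ex_bump (c : ℕ → ℤ) (n : Fin ν → ℕ) (p : Fin ν) :
    ex c (bump n p) = ex (fun i => c i + 2 * min (i : ℤ) ((p : ℕ) + 1 : ℤ)) n +
      ((p : ℕ) + 1 + c ((p : ℕ) + 1)) := by
  unfold ex
  rw [sum_bump]
  have h1 : ∑ i ∈ Finset.Icc 1 ν, ((NN (bump n p) i : ℤ)) ^ 2 =
      ∑ i ∈ Finset.Icc 1 ν, ((NN n i : ℤ)) ^ 2 +
        2 * ∑ l ∈ Finset.Icc 1 ((p : ℕ) + 1), (NN n l : ℤ) + ((p : ℕ) + 1) := by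
    have e1 : ∑ l ∈ Finset.Icc 1 ((p : ℕ) + 1), (NN n l : ℤ) =
        ∑ l ∈ Finset.Icc 1 ν, if l ≤ (p : ℕ) + 1 then (NN n l : ℤ) else 0 := by
      rw [← Finset.sum_filter]
      apply Finset.sum_congr _ (fun _ _ => rfl)
      ext l; simp only [Finset.mem_Icc, Finset.mem_filter]; have := p.2; omega
    have e2 : ((p : ℕ) + 1 : ℤ) = ∑ l ∈ Finset.Icc 1 ν, if l ≤ (p : ℕ) + 1 then (1 : ℤ) else 0 := by
      rw [sum_Icc_ite]; have := p.2; push_cast; omega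
    rw [e1, e2, Finset.mul_sum, ← Finset.sum_add_distrib, ← Finset.sum_add_distrib]
    apply Finset.sum_congr rfl
    intro l _
    rw [NN_bump]; push_cast
    split_ifs <;> ring
  rw [h1, sumNN]
  simp only [add_mul, Finset.sum_add_distrib, Finset.mul_sum]
  have : ∀ k : Fin ν, (2 : ℤ) * (min (((p : ℕ) + 1 : ℕ) : ℤ) ((k : ℕ) + 1 : ℤ) * n k) =
      2 * min (((k : ℕ) + 1 : ℕ) : ℤ) ((p : ℕ) + 1 : ℤ) * n k := by
    intro k; push_cast; rw [min_comm]; ring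
  simp only [this]
  ring

lemma ex_single (c : ℕ → ℤ) (n : Fin ν → ℕ) (p : Fin ν) :
    ex (fun i => c i + if i = (p : ℕ) + 1 then 1 else 0) n = ex c n + n p := by
  unfold ex
  simp [add_mul, Finset.sum_add_distrib, Fin.val_inj]
  ring

/-- The second piece of the Pascal splitting. -/
def SS (a c : ℕ → ℤ) (L : ℤ) (p : Fin ν) (n : Fin ν → ℕ) : K :=
  RatFunc.X ^ ex c n * ∏ i : Fin ν,
    if i = p then qB RatFunc.X ((n i : ℤ) + (mm a L n ((i : ℕ) + 1) - 1)) (n i - 1)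
    else qB RatFunc.X ((n i : ℤ) + mm a L n ((i : ℕ) + 1)) (n i)

lemma X_ne : (RatFunc.X : K) ≠ 0 := RatFunc.X_ne_zero

lemma TT_split (a c : ℕ → ℤ) (L : ℤ) (p : Fin ν) (n : Fin ν → ℕ) (ha0 : a 0 = 0)
    (hp : ((p : ℕ) + 1 < ν ∧ 0 < a p + a ((p : ℕ) + 2) - 2 * a ((p : ℕ) + 1)) ∨
      ((p : ℕ) + 1 = ν ∧ a ((p : ℕ) + 1) - a p < L)) :
    TT a c L n = TT (fun i => a i + if i = (p : ℕ) + 1 then 1 else 0)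
        (fun i => c i + if i = (p : ℕ) + 1 then 1 else 0) L n + SS a c L p n := by
  have hmm : ∀ i : Fin ν, mm (fun i => a i + if i = (p : ℕ) + 1 then 1 else 0) L n ((i : ℕ) + 1) =
      mm a L n ((i : ℕ) + 1) - if i = p then 1 else 0 := by
    intro i; unfold mm; simp only [Nat.add_right_cancel_iff, Fin.val_inj]; ring
  unfold TT SS
  rw [ex_single, zpow_add₀ X_ne]
  simp only [hmm]
  by_cases h0 : n p = 0 ∧ mm a L n ((p : ℕ) + 1) = 0
  · obtain ⟨h0, h1⟩ := h0
    have z1 : ∏ i : Fin ν, qB (RatFunc.X : K) ((n i : ℤ) + mm a L n ((i : ℕ) + 1)) (n i) = 0 := by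
      have hm0 : mm a L n 0 = 0 := by simp [mm, ha0]
      have hd1 : mm a L n ((p : ℕ) + 1) = mm a L n p + L - 2 * NN n ((p : ℕ) + 1) -
          (a ((p : ℕ) + 1) - a p) := by
        unfold mm; rw [Finset.sum_Icc_succ_top (by omega)]; push_cast; ring
      have hd2 : mm a L n ((p : ℕ) + 2) = mm a L n ((p : ℕ) + 1) + L - 2 * NN n ((p : ℕ) + 2) -
          (a ((p : ℕ) + 2) - a ((p : ℕ) + 1)) := by
        unfold mm; rw [Finset.sum_Icc_succ_top (by omega)]; push_cast; ring
      have hs := NN_succ n p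
      have hneg : mm a L n p < 0 → ∏ i : Fin ν,
          qB (RatFunc.X : K) ((n i : ℤ) + mm a L n ((i : ℕ) + 1)) (n i) = 0 := by
        intro h
        apply prod_zero a L n p _ p.2.le h
        by_contra hc
        have : (p : ℕ) = 0 := by omega
        rw [this] at h; omega
      rcases hp with ⟨hp1, hp2⟩ | ⟨hp1, hp2⟩
      · rcases lt_or_ge (mm a L n p) 0 with h | h
        · exact hneg h
        · exact prod_zero a L n (p + 2) (by omega) (by omega) (by omega)
      · have := NN_top n ((p : ℕ) + 2) (by omega)
        exact hneg (by omega)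
    rw [z1]
    rw [Finset.prod_eq_zero (Finset.mem_univ p) (i := p)]
    · rw [Finset.prod_eq_zero (Finset.mem_univ p) (i := p)]
      · simp
      · simp only [if_true]; unfold qB; rw [if_neg (by omega)]
    · simp only [if_true]; unfold qB; rw [if_neg (by omega)]
  · have hP := qB_pascal (n p) (mm a L n ((p : ℕ) + 1)) h0
    rw [← Finset.mul_prod_erase _ _ (Finset.mem_univ p),
      ← Finset.mul_prod_erase Finset.univ (fun i : Fin ν => if i = p then
        qB (RatFunc.X : K) ((n i : ℤ) + (mm a L n ((i : ℕ) + 1) - 1)) (n i - 1)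
        else qB RatFunc.X ((n i : ℤ) + mm a L n ((i : ℕ) + 1)) (n i)) (Finset.mem_univ p),
      ← Finset.mul_prod_erase Finset.univ (fun i : Fin ν =>
        qB (RatFunc.X : K) ((n i : ℤ) + (mm a L n ((i : ℕ) + 1) - if i = p then 1 else 0)) (n i))
        (Finset.mem_univ p)]
    have c1 : ∏ i ∈ Finset.univ.erase p, (if i = p then
        qB (RatFunc.X : K) ((n i : ℤ) + (mm a L n ((i : ℕ) + 1) - 1)) (n i - 1)
        else qB RatFunc.X ((n i : ℤ) + mm a L n ((i : ℕ) + 1)) (n i)) =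
        ∏ i ∈ Finset.univ.erase p, qB RatFunc.X ((n i : ℤ) + mm a L n ((i : ℕ) + 1)) (n i) := by
      apply Finset.prod_congr rfl
      intro i hi; rw [if_neg (Finset.ne_of_mem_erase hi)]
    have c2 : ∏ i ∈ Finset.univ.erase p,
        qB (RatFunc.X : K) ((n i : ℤ) + (mm a L n ((i : ℕ) + 1) - if i = p then 1 else 0)) (n i) =
        ∏ i ∈ Finset.univ.erase p, qB RatFunc.X ((n i : ℤ) + mm a L n ((i : ℕ) + 1)) (n i) := by
      apply Finset.prod_congr rfl
      intro i hi; rw [if_neg (Finset.ne_of_mem_erase hi), sub_zero]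
    rw [c1, c2, hP]
    simp only [if_true]
    ring

lemma SS_bump (a c : ℕ → ℤ) (L : ℤ) (p : Fin ν) (n : Fin ν → ℕ) :
    SS a c L p (bump n p) = RatFunc.X ^ ((p : ℕ) + 1 + c ((p : ℕ) + 1) : ℤ) *
      TT (fun i => a i + 2 * min (i : ℤ) ((p : ℕ) + 1 : ℤ))
        (fun i => c i + 2 * min (i : ℤ) ((p : ℕ) + 1 : ℤ)) L n := by
  unfold SS TT
  rw [ex_bump, zpow_add₀ X_ne]
  have hmm : ∀ i : ℕ, mm (fun i => a i + 2 * min (i : ℤ) ((p : ℕ) + 1 : ℤ)) L n i =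
      mm a L (bump n p) i := by
    intro i; unfold mm; rw [sumNN_bump]; ring
  have : ∀ i : Fin ν, (if i = p then qB (RatFunc.X : K) ((bump n p i : ℤ) +
      (mm a L (bump n p) ((i : ℕ) + 1) - 1)) (bump n p i - 1)
      else qB RatFunc.X ((bump n p i : ℤ) + mm a L (bump n p) ((i : ℕ) + 1)) (bump n p i)) =
      qB RatFunc.X ((n i : ℤ) + mm a L (bump n p) ((i : ℕ) + 1)) (n i) := by
    intro i
    by_cases hi : i = p
    · rw [if_pos hi]; unfold bump; simp only [hi, if_true]
      congr 1 <;> push_cast <;> ring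
    · rw [if_neg hi]
      have : bump n p i = n i := by simp [bump, hi]
      rw [this]
  simp only [this, hmm]
  ring

lemma SS_zero (a c : ℕ → ℤ) (L : ℤ) (p : Fin ν) (n : Fin ν → ℕ) (h : n p = 0) :
    SS a c L p n = 0 := by
  unfold SS
  rw [Finset.prod_eq_zero (Finset.mem_univ p) (i := p), mul_zero]
  rw [if_pos rfl]; unfold qB; rw [if_neg (by omega)]

lemma bump_inj (p : Fin ν) : Function.Injective (fun n : Fin ν → ℕ => bump n p) := by
  intro n n' h
  funext k
  have := congrFun h k
  simpa [bump] using this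

lemma SS_finsum (a c : ℕ → ℤ) (L : ℤ) (p : Fin ν) :
    ∑ᶠ n, SS a c L p n = ∑ᶠ n, SS a c L p (bump n p) := by
  rw [← finsum_mem_range (f := SS a c L p) (bump_inj p), finsum_mem_def]
  apply finsum_congr
  intro n
  by_cases h : n ∈ Set.range (fun n : Fin ν → ℕ => bump n p)
  · rw [Set.indicator_of_mem h]
  · rw [Set.indicator_of_notMem h]
    apply SS_zero
    by_contra hc
    apply h
    refine ⟨fun k => n k - if k = p then 1 else 0, ?_⟩
    funext k
    simp only [bump]
    by_cases hk : k = p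
    · subst hk; simp only [if_true]; omega
    · simp [hk]

/-- The basic recurrence. -/
lemma FF_rec (hν : 1 ≤ ν) (a c : ℕ → ℤ) (L : ℤ) (p : Fin ν) (ha0 : a 0 = 0)
    (hp : ((p : ℕ) + 1 < ν ∧ 0 < a p + a ((p : ℕ) + 2) - 2 * a ((p : ℕ) + 1)) ∨
      ((p : ℕ) + 1 = ν ∧ a ((p : ℕ) + 1) - a p < L)) :
    FF ν a c L = FF ν (fun i => a i + if i = (p : ℕ) + 1 then 1 else 0)
        (fun i => c i + if i = (p : ℕ) + 1 then 1 else 0) L +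
      RatFunc.X ^ ((p : ℕ) + 1 + c ((p : ℕ) + 1) : ℤ) *
      FF ν (fun i => a i + 2 * min (i : ℤ) ((p : ℕ) + 1 : ℤ))
        (fun i => c i + 2 * min (i : ℤ) ((p : ℕ) + 1 : ℤ)) L := by
  have hS : ∀ n, SS a c L p n = TT a c L n - TT (fun i => a i + if i = (p : ℕ) + 1 then 1 else 0)
        (fun i => c i + if i = (p : ℕ) + 1 then 1 else 0) L n := by
    intro n; rw [TT_split a c L p n ha0 hp]; ring
  have f1 := TT_finite hν a c L
  have f2 := TT_finite hν (fun i => a i + if i = (p : ℕ) + 1 then 1 else 0)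
        (fun i => c i + if i = (p : ℕ) + 1 then 1 else 0) L
  have h1 : ∑ᶠ n, SS a c L p n = FF ν a c L - FF ν (fun i => a i + if i = (p : ℕ) + 1 then 1 else 0)
        (fun i => c i + if i = (p : ℕ) + 1 then 1 else 0) L := by
    unfold FF
    rw [← finsum_sub_distrib f1 f2]
    exact finsum_congr hS
  rw [SS_finsum] at h1
  simp only [SS_bump] at h1
  rw [← mul_finsum] at h1
  unfold FF at h1 ⊢
  rw [h1]; ring

/-! ### Words of slopes -/

/-- The swap relation. -/
def Rel (ν : ℕ) (e : ℤ) (H : List ℤ → K) : Prop :=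
  ∀ (u : List ℤ) (d : ℤ) (w : List ℤ), u.length + 2 + w.length = ν →
    H (u ++ d :: (d + 1) :: w) = H (u ++ (d + 1) :: d :: w) +
      RatFunc.X ^ (e * (u.length + 1) + (u.length + 1) + u.sum + d : ℤ) *
        H ((u ++ [d]).map (fun z => z + 2) ++ (d + 1) :: w)

lemma move_left {e : ℤ} {H : List ℤ → K} (hH : Rel ν e H) (u : List ℤ) (t : ℕ) :
    ∀ w : List ℤ, u.length + t + 1 + w.length = ν →
    H (u ++ (List.replicate t (-1) ++ 0 :: w)) = H (u ++ 0 :: (List.replicate t (-1) ++ w)) +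
      ∑ m ∈ Finset.range t,
        RatFunc.X ^ (e * (u.length + m + 1) + (u.length + u.sum) : ℤ) *
        H (u.map (fun z => z + 2) ++ (List.replicate (m + 1) 1 ++
          0 :: (List.replicate (t - 1 - m) (-1) ++ w))) := by
  induction t with
  | zero => intro w _; simp
  | succ t ih =>
    intro w hw
    have h1 := hH (u ++ List.replicate t (-1)) (-1) w (by simp; omega)
    have h2 := ih (-1 :: w) (by simp; omega)
    have e1 : u ++ (List.replicate (t + 1) (-1) ++ 0 :: w) =
        u ++ List.replicate t (-1) ++ -1 :: (-1 + 1) :: w := by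
      simp [List.replicate_succ']
    have e2 : u ++ List.replicate t (-1) ++ (-1 + 1) :: -1 :: w =
        u ++ (List.replicate t (-1) ++ 0 :: -1 :: w) := by simp
    have e3 : u ++ 0 :: (List.replicate t (-1) ++ -1 :: w) =
        u ++ 0 :: (List.replicate (t + 1) (-1) ++ w) := by
      simp [List.replicate_succ']
    rw [e1, h1, e2, h2, e3, Finset.sum_range_succ, add_assoc]
    congr 1
    congr 1
    · apply Finset.sum_congr rfl
      intro m hm
      have hm := Finset.mem_range.mp hm
      have e4 : t + 1 - 1 - m = (t - 1 - m) + 1 := by omega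
      have e5 : List.replicate (t - 1 - m + 1) (-1 : ℤ) ++ w =
          List.replicate (t - 1 - m) (-1) ++ -1 :: w := by simp [List.replicate_succ']
      rw [e4, e5]
    · congr 1
      · congr 1; simp; ring
      · congr 1
        simp [List.replicate_succ']

lemma move_right {e : ℤ} {H : List ℤ → K} (hH : Rel ν e H) (u : List ℤ) (j : ℕ) :
    ∀ w : List ℤ, u.length + j + 1 + w.length = ν →
    H (u ++ 0 :: (List.replicate j 1 ++ w)) = H (u ++ (List.replicate j 1 ++ 0 :: w)) +
      ∑ l ∈ Finset.range j,
        RatFunc.X ^ (e * (u.length + l + 1) + (u.length + 2 * l + 1 + u.sum) : ℤ) *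
        H (u.map (fun z => z + 2) ++ (List.replicate l 3 ++
          2 :: (List.replicate (j - l) 1 ++ w))) := by
  induction j with
  | zero => intro w _; simp
  | succ j ih =>
    intro w hw
    have h1 := hH (u ++ List.replicate j 1) 0 w (by simp; omega)
    have h2 := ih (1 :: w) (by simp; omega)
    have e1 : u ++ 0 :: (List.replicate (j + 1) 1 ++ w) =
        u ++ 0 :: (List.replicate j 1 ++ 1 :: w) := by
      simp [List.replicate_succ']
    have e2 : u ++ (List.replicate j 1 ++ 0 :: 1 :: w) =
        u ++ List.replicate j 1 ++ 0 :: (0 + 1) :: w := by simp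
    have e3 : u ++ List.replicate j 1 ++ (0 + 1) :: 0 :: w =
        u ++ (List.replicate (j + 1) 1 ++ 0 :: w) := by
      simp [List.replicate_succ']
    rw [e1, h2, e2, h1, e3, Finset.sum_range_succ, add_right_comm, add_assoc]
    congr 1
    congr 1
    · apply Finset.sum_congr rfl
      intro m hm
      have hm := Finset.mem_range.mp hm
      have e4 : j + 1 - m = (j - m) + 1 := by omega
      rw [e4, List.replicate_succ']
      simp
    · congr 1
      · congr 1; simp; ring
      · congr 1
        simp

lemma triangle (Φ : ℕ → ℕ → K) (t : ℕ) :
    ∑ j ∈ Finset.range (t + 1), ∑ m ∈ Finset.range (t - j), Φ j (j + m + 1) =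
      ∑ j ∈ Finset.range (t + 1), ∑ l ∈ Finset.range j, Φ l j := by
  induction t with
  | zero => simp
  | succ t ih =>
    rw [Finset.sum_range_succ, Finset.sum_range_succ _ (t + 1), ← ih]
    simp only [Nat.sub_self, Finset.range_zero, Finset.sum_empty, add_zero]
    rw [← Finset.sum_add_distrib]
    apply Finset.sum_congr rfl
    intro j hj
    have hj := Finset.mem_range.mp hj
    have e : t + 1 - j = (t - j) + 1 := by omega
    rw [e, Finset.sum_range_succ]
    congr 2
    omega

lemma slide {e : ℤ} {H : List ℤ → K} (hH : Rel ν e H) (r t : ℕ) (w : List ℤ)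
    (hl : r + t + 2 + w.length = ν) :
    ∑ j ∈ Finset.range (t + 1), RatFunc.X ^ (e * j : ℤ) *
      H (List.replicate r 0 ++ (List.replicate j 1 ++ 0 :: (List.replicate (t - j) (-1) ++ 0 :: w))) =
    ∑ j ∈ Finset.range (t + 1), RatFunc.X ^ (e * j : ℤ) *
      H (List.replicate (r + 1) 0 ++ (List.replicate j 1 ++ 0 :: (List.replicate (t - j) (-1) ++ w))) := by
  have hL : ∀ j ∈ Finset.range (t + 1), RatFunc.X ^ (e * j : ℤ) *
      H (List.replicate r 0 ++ (List.replicate j 1 ++ 0 :: (List.replicate (t - j) (-1) ++ 0 :: w))) =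
      RatFunc.X ^ (e * j : ℤ) * H (List.replicate r 0 ++ (List.replicate j 1 ++ 0 :: 0 ::
        (List.replicate (t - j) (-1) ++ w))) + ∑ m ∈ Finset.range (t - j),
        (fun l k : ℕ => (RatFunc.X : K) ^ (e * k + (e * (r + l + 1) + (r + 2 * l + 1)) : ℤ) *
          H (List.replicate r 2 ++ (List.replicate l 3 ++ 2 :: (List.replicate (k - l) 1 ++
            0 :: (List.replicate (t - k) (-1) ++ w))))) j (j + m + 1) := by
    intro j hj
    have hj := Finset.mem_range.mp hj
    have h := move_left hH (List.replicate r 0 ++ (List.replicate j 1 ++ [0])) (t - j) w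
      (by simp; omega)
    simp only [List.append_assoc, List.cons_append, List.nil_append] at h
    rw [h, mul_add, Finset.mul_sum]
    congr 1
    apply Finset.sum_congr rfl
    intro m hm
    have hm := Finset.mem_range.mp hm
    simp only
    rw [← mul_assoc, ← zpow_add₀ X_ne]
    have e1 : j + m + 1 - j = m + 1 := by omega
    have e2 : t - (j + m + 1) = t - j - 1 - m := by omega
    rw [e1, e2]
    congr 1
    · congr 1; simp; ring
    · simp
  have hR : ∀ j ∈ Finset.range (t + 1), RatFunc.X ^ (e * j : ℤ) *
      H (List.replicate (r + 1) 0 ++ (List.replicate j 1 ++ 0 :: (List.replicate (t - j) (-1) ++ w))) =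
      RatFunc.X ^ (e * j : ℤ) * H (List.replicate r 0 ++ (List.replicate j 1 ++ 0 :: 0 ::
        (List.replicate (t - j) (-1) ++ w))) + ∑ l ∈ Finset.range j,
        (fun l k : ℕ => (RatFunc.X : K) ^ (e * k + (e * (r + l + 1) + (r + 2 * l + 1)) : ℤ) *
          H (List.replicate r 2 ++ (List.replicate l 3 ++ 2 :: (List.replicate (k - l) 1 ++
            0 :: (List.replicate (t - k) (-1) ++ w))))) l j := by
    intro j hj
    have hj := Finset.mem_range.mp hj
    have h := move_right hH (List.replicate r 0) j (0 :: (List.replicate (t - j) (-1) ++ w))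
      (by simp; omega)
    have e0 : List.replicate (r + 1) (0 : ℤ) ++ (List.replicate j 1 ++ 0 :: (List.replicate (t - j) (-1) ++ w)) =
      List.replicate r 0 ++ 0 :: (List.replicate j 1 ++ 0 :: (List.replicate (t - j) (-1) ++ w)) := by
      simp [List.replicate_succ']
    rw [e0, h, mul_add, Finset.mul_sum]
    congr 1
    apply Finset.sum_congr rfl
    intro l hl
    simp only
    rw [← mul_assoc, ← zpow_add₀ X_ne]
    congr 1
    · congr 1; simp
    · simp
  rw [Finset.sum_congr rfl hL, Finset.sum_congr rfl hR, Finset.sum_add_distrib,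
    Finset.sum_add_distrib]
  congr 1
  exact triangle (fun l k : ℕ => (RatFunc.X : K) ^ (e * k + (e * (r + l + 1) + (r + 2 * l + 1)) : ℤ) *
          H (List.replicate r 2 ++ (List.replicate l 3 ++ 2 :: (List.replicate (k - l) 1 ++
            0 :: (List.replicate (t - k) (-1) ++ w))))) t

lemma slide_all {e : ℤ} {H : List ℤ → K} (hH : Rel ν e H) (t r : ℕ) :
    ∀ w : List ℤ, r + t + 1 + w.length = ν →
    ∑ j ∈ Finset.range (t + 1), RatFunc.X ^ (e * j : ℤ) *
      H (List.replicate j 1 ++ 0 :: (List.replicate (t - j) (-1) ++ (List.replicate r 0 ++ w))) =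
    ∑ j ∈ Finset.range (t + 1), RatFunc.X ^ (e * j : ℤ) *
      H (List.replicate r 0 ++ (List.replicate j 1 ++ 0 :: (List.replicate (t - j) (-1) ++ w))) := by
  induction r with
  | zero => intro w _; simp
  | succ r ih =>
    intro w hw
    rw [← slide hH r t w (by omega), ← ih (0 :: w) (by simp; omega)]
    simp [List.replicate_succ']

lemma claim {e : ℤ} {H : List ℤ → K} (hH : Rel ν e H) (s t : ℕ) (h : s + 1 + t = ν) :
    H (List.replicate t (-1) ++ List.replicate (s + 1) 0) =
    ∑ j ∈ Finset.range (t + 1), RatFunc.X ^ (e * j : ℤ) *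
      H (List.replicate s 0 ++ (List.replicate j 1 ++ 0 :: List.replicate (t - j) (-1))) := by
  have h1 := slide_all hH t s [] (by simp; omega)
  simp only [List.append_nil] at h1
  rw [← h1]
  have h2 := move_left hH [] t (List.replicate s 0) (by simp; omega)
  simp only [List.nil_append, List.map_nil] at h2
  rw [List.replicate_succ, h2, Finset.sum_range_succ', add_comm]
  congr 1
  · apply Finset.sum_congr rfl
    intro m hm
    congr 1
    · congr 1; simp
    · congr 5; omega
  · simp

/-- Partial sums of slopes. -/
def cum (d : List ℤ) (i : ℕ) : ℤ := (d.take i).sum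

lemma cum_append (u v : List ℤ) (i : ℕ) : cum (u ++ v) i = cum u i + cum v (i - u.length) := by
  simp [cum, List.take_append]

lemma cum_of_le (u : List ℤ) (i : ℕ) (h : u.length ≤ i) : cum u i = u.sum := by
  simp [cum, List.take_of_length_le h]

@[simp] lemma cum_zero (u : List ℤ) : cum u 0 = 0 := by simp [cum]
@[simp] lemma cum_nil (i : ℕ) : cum [] i = 0 := by simp [cum]
@[simp] lemma cum_cons (x : ℤ) (u : List ℤ) (i : ℕ) : cum (x :: u) (i + 1) = x + cum u i := by
  simp [cum]

lemma cum_map (u : List ℤ) (k : ℤ) (i : ℕ) :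
    cum (u.map (fun z => z + k)) i = cum u i + k * min (i : ℤ) u.length := by
  induction u generalizing i with
  | nil => simp
  | cons x u ih =>
    rcases i with _ | i
    · simp; right; omega
    · simp only [List.map_cons, cum_cons, ih, List.length_cons]
      push_cast
      rw [min_add_add_right]; ring

lemma cum_replicate (m : ℕ) (x : ℤ) (i : ℕ) : cum (List.replicate m x) i = x * min (i : ℤ) m := by
  simp [cum, List.take_replicate]; ring

lemma FF_congr {a a' c c' : ℕ → ℤ} {L L' : ℤ}
    (ha : ∀ i, 1 ≤ i → i ≤ ν → i * L - a i = i * L' - a' i) (hc : ∀ i, 1 ≤ i → i ≤ ν → c i = c' i) :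
    FF ν a c L = FF ν a' c' L' := by
  unfold FF
  apply finsum_congr
  intro n
  unfold TT
  congr 1
  · congr 1
    unfold ex
    congr 1
    apply Finset.sum_congr rfl
    intro k _
    rw [hc _ (by omega) (by omega)]
  · apply Finset.prod_congr rfl
    intro i _
    congr 2
    unfold mm
    have := ha (i + 1) (by omega) (by omega)
    push_cast at this ⊢
    linarith

/-- The fermionic sum attached to a word of slopes. -/
def HH (ν b : ℕ) (L e : ℤ) (d : List ℤ) : K :=
  FF ν (fun i => cum d i + alph i b) (fun i => cum d i + e * i) L

lemma HH_rel (hν : 1 ≤ ν) (b : ℕ) (L e : ℤ) : Rel ν e (HH ν b L e) := by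
  intro u d w hl
  have hp := FF_rec hν (fun i => cum (u ++ d :: (d + 1) :: w) i + alph i b)
    (fun i => cum (u ++ d :: (d + 1) :: w) i + e * i) L ⟨u.length, by omega⟩
    (by simp [alph]) (by
      left
      refine ⟨by simp only; omega, ?_⟩
      simp only
      rw [cum_append, cum_append, cum_append, cum_of_le u _ le_rfl, cum_of_le u _ (by omega),
        cum_of_le u _ (by omega)]
      have e1 : u.length + 1 - u.length = 0 + 1 := by omega
      have e2 : u.length + 2 - u.length = 0 + 1 + 1 := by omega
      rw [e1, e2, Nat.sub_self]
      simp only [cum_cons, cum_zero, alph]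
      push_cast
      omega)
  unfold HH
  rw [hp]
  have key1 : ∀ i, cum (u ++ (d + 1) :: d :: w) i = cum (u ++ d :: (d + 1) :: w) i +
      if i = u.length + 1 then 1 else 0 := by
    intro i
    rw [cum_append, cum_append]
    rcases Nat.lt_or_ge u.length i with h | h
    · obtain ⟨j, rfl⟩ : ∃ j, i = u.length + 1 + j := ⟨i - u.length - 1, by omega⟩
      have : u.length + 1 + j - u.length = j + 1 := by omega
      rw [this]
      rcases j with _ | j
      · simp; ring
      · rw [if_neg (by omega)]; simp only [cum_cons]; ring
    · rw [if_neg (by omega), Nat.sub_eq_zero_of_le h]; simp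
  have key2 : ∀ i, cum ((u ++ [d]).map (fun z => z + 2) ++ (d + 1) :: w) i =
      cum (u ++ d :: (d + 1) :: w) i + 2 * min (i : ℤ) ((u.length : ℤ) + 1) := by
    intro i
    have : u ++ d :: (d + 1) :: w = (u ++ [d]) ++ (d + 1) :: w := by simp
    rw [this, cum_append, cum_append _ _ i, cum_map]
    simp only [List.length_map, List.length_append, List.length_cons, List.length_nil]
    push_cast; ring
  congr 1
  · apply FF_congr
    · intro i _ _; simp only [key1]; ring
    · intro i _ _; simp only [key1]; ring
  · congr 1
    · congr 1
      simp only
      rw [cum_append, cum_of_le u _ (by omega)]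
      have e1 : u.length + 1 - u.length = 0 + 1 := by omega
      rw [e1, cum_cons, cum_zero]; push_cast; ring
    · apply FF_congr
      · intro i _ _; simp only [key2]; ring
      · intro i _ _; simp only [key2]; ring

lemma HH_last (b : ℕ) (L e : ℤ) (u : List ℤ) (hl : u.length + 1 = ν) (hL : 2 ≤ L) :
    HH ν b L e (u ++ [0]) = HH ν b L e (u ++ [1]) +
      RatFunc.X ^ (ν + u.sum + e * ν : ℤ) * HH ν b L e ((u ++ [0]).map (fun z => z + 2)) := by
  have hp := FF_rec (by omega) (fun i => cum (u ++ [0]) i + alph i b)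
    (fun i => cum (u ++ [0]) i + e * i) L (⟨u.length, by omega⟩ : Fin ν)
    (by simp [alph]) (by
      right
      refine ⟨by simp only; omega, ?_⟩
      simp only
      rw [cum_append, cum_append, cum_of_le u _ le_rfl, cum_of_le u _ (by omega)]
      have e1 : u.length + 1 - u.length = 0 + 1 := by omega
      rw [e1, Nat.sub_self]
      simp only [cum_cons, cum_zero, alph]
      push_cast
      omega)
  unfold HH
  rw [hp]
  have key1 : ∀ i ≤ ν, cum (u ++ [1]) i = cum (u ++ [0]) i +
      if i = u.length + 1 then 1 else 0 := by
    intro i hi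
    rw [cum_append, cum_append]
    rcases Nat.lt_or_ge u.length i with h | h
    · obtain rfl : i = u.length + 1 := by omega
      have : u.length + 1 - u.length = 0 + 1 := by omega
      rw [this]
      simp
    · rw [if_neg (by omega), Nat.sub_eq_zero_of_le h]; simp
  congr 1
  · apply FF_congr
    · intro i _ h; simp only [key1 i h]; ring
    · intro i _ h; simp only [key1 i h]; ring
  · congr 1
    · congr 1
      simp only
      rw [cum_append, cum_of_le u _ (by omega)]
      have e1 : u.length + 1 - u.length = 0 + 1 := by omega
      rw [e1, cum_cons, cum_zero, ← hl]; push_cast; ring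
    · apply FF_congr
      · intro i _ _; simp only [cum_map, List.length_append, List.length_cons, List.length_nil]; push_cast; ring
      · intro i _ _; simp only [cum_map, List.length_append, List.length_cons, List.length_nil]; push_cast; ring

lemma HH_shift (b : ℕ) (L e : ℤ) (d : List ℤ) (hl : d.length = ν) :
    HH ν b L e (d.map (fun z => z + 1)) = HH ν b (L - 1) (e + 1) d := by
  unfold HH
  apply FF_congr
  · intro i _ h
    have : min (i : ℤ) d.length = i := by omega
    simp only [cum_map, this]; ring
  · intro i _ h
    have : min (i : ℤ) d.length = i := by omega
    simp only [cum_map, this]; ring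

lemma HH_rel2 (hν : 1 ≤ ν) (b : ℕ) (L e : ℤ) :
    Rel ν (e + 2) (fun d => HH ν b L e (d.map (fun z => z + 2))) := by
  intro u d w hl
  have h := HH_rel hν b L e (u.map (fun z => z + 2)) (d + 2) (w.map (fun z => z + 2)) (by simpa using hl)
  have e0 : d + 2 + 1 = d + 1 + 2 := by ring
  rw [e0] at h
  simp only [List.map_append, List.map_cons, List.map_nil] at h ⊢
  rw [h]
  congr 3
  have : (u.map (fun z => z + 2)).sum = u.sum + 2 * u.length := by
    rw [List.sum_map_add]; simp; ring
  rw [this, List.length_map]; ring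

/-- The recurrence of the fermionic sums in `s`. -/
lemma HH_step (b : ℕ) (L e : ℤ) (hL : 2 ≤ L) (s t : ℕ) (h : s + 1 + t = ν) :
    HH ν b L e (List.replicate (s + 1) 0 ++ List.replicate t 1) =
      HH ν b L e (List.replicate s 0 ++ List.replicate (t + 1) 1) +
      RatFunc.X ^ ((s + 1) * (e + 1) : ℤ) *
        HH ν b (L - 1) (e + 1) (List.replicate t 0 ++ List.replicate (s + 1) 1) := by
  have hν : 1 ≤ ν := by omega
  have h1 := move_right (HH_rel hν b L e) (List.replicate s 0) t [] (by simp; omega)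
  have h2 := HH_last (ν := ν) b L e (List.replicate s 0 ++ List.replicate t 1) (by simp; omega) hL
  have h3 := claim (HH_rel2 hν b L e) s t h
  have h4 := HH_shift (ν := ν) b L e (List.replicate t 0 ++ List.replicate (s + 1) 1) (by simp; omega)
  rw [← h4]
  have e4 : (List.replicate t (0 : ℤ) ++ List.replicate (s + 1) 1).map (fun z => z + 1) =
      (List.replicate t (-1) ++ List.replicate (s + 1) 0).map (fun z => z + 2) := by simp
  rw [e4]
  rw [h3]
  have e1 : List.replicate (s + 1) (0 : ℤ) ++ List.replicate t 1 =
      List.replicate s 0 ++ 0 :: (List.replicate t 1 ++ []) := by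
    simp [List.replicate_succ']
  have e2 : List.replicate s (0 : ℤ) ++ List.replicate (t + 1) 1 =
      List.replicate s 0 ++ List.replicate t 1 ++ [1] := by
    simp [List.replicate_succ']
  have e3 : List.replicate s (0 : ℤ) ++ (List.replicate t 1 ++ [0]) =
      List.replicate s 0 ++ List.replicate t 1 ++ [0] := by simp
  rw [e1, h1, e3, h2, e2, add_assoc]
  congr 1
  rw [Finset.sum_range_succ, mul_add, Finset.mul_sum]
  rw [add_comm]
  congr 1
  · apply Finset.sum_congr rfl
    intro j hj
    have hj := Finset.mem_range.mp hj
    rw [← mul_assoc, ← zpow_add₀ X_ne]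
    congr 1
    · congr 1; simp; ring
    · simp
  · rw [← mul_assoc, ← zpow_add₀ X_ne]
    congr 1
    · congr 1; simp; rw [← h]; push_cast; ring
    · simp

/-! ### Iterating the recurrence -/

lemma HH_rec (b : ℕ) (L e : ℤ) (hL : 2 ≤ L) (s : ℕ) (hs : s ≤ ν) :
    HH ν b L e (List.replicate s 0 ++ List.replicate (ν - s) 1) =
      ∑ f ∈ Finset.range (s + 1), RatFunc.X ^ (f * (e + 1) : ℤ) *
        HH ν b (L - 1) (e + 1) (List.replicate (ν - f) 0 ++ List.replicate (ν - (ν - f)) 1) := by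
  induction s with
  | zero =>
    have h := HH_shift (ν := ν) b L e (List.replicate ν 0) (by simp)
    simp at h ⊢
    exact h
  | succ s ih =>
    have h := HH_step (ν := ν) b L e hL s (ν - (s + 1)) (by omega)
    have e1 : ν - (s + 1) + 1 = ν - s := by omega
    have e2 : ν - (ν - (s + 1)) = s + 1 := by omega
    rw [h, e1, ih (by omega), Finset.sum_range_succ _ (s + 1), e2]
    push_cast
    rfl

/-- The Gordon-side recursion; `Gam ν k s b e` belongs to length `k + 1`. -/
def Gam (ν : ℕ) : ℕ → ℕ → ℕ → ℤ → K
  | 0, s, b, _ => if ν ≤ s + b then 1 else 0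
  | k + 1, s, b, e => ∑ f ∈ Finset.range (s + 1), RatFunc.X ^ (f * (e + 1) : ℤ) *
      Gam ν k (ν - f) b (e + 1)

lemma cum_alph (s i : ℕ) (hs : s ≤ ν) (hi : i ≤ ν) :
    cum (List.replicate s 0 ++ List.replicate (ν - s) 1) i = alph i s := by
  rw [cum_append, cum_replicate, cum_replicate]
  simp only [List.length_replicate, alph]
  omega

lemma HH_base (hν : 1 ≤ ν) (s b : ℕ) (hs : s ≤ ν) (hb : b ≤ ν) (e : ℤ) :
    HH ν b 1 e (List.replicate s 0 ++ List.replicate (ν - s) 1) = if ν ≤ s + b then 1 else 0 := by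
  have h0 : ∀ i, NN (fun _ : Fin ν => 0) i = 0 := by intro i; simp [NN]
  unfold HH FF
  rw [finsum_eq_single _ (fun _ => 0)]
  · split_ifs with h
    · unfold TT
      have : ex (fun i => cum (List.replicate s 0 ++ List.replicate (ν - s) 1) i + e * i)
          (fun _ : Fin ν => 0) = 0 := by simp [ex, h0]
      rw [this, zpow_zero, one_mul]
      apply Finset.prod_eq_one
      intro i _
      have hm : 0 ≤ mm (fun i => cum (List.replicate s 0 ++ List.replicate (ν - s) 1) i + alph i b) 1
          (fun _ : Fin ν => 0) ((i : ℕ) + 1) := by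
        unfold mm
        simp only [h0]
        rw [cum_alph s _ hs (by omega)]
        simp [alph]
        have := i.2
        omega
      obtain ⟨k, hk⟩ := Int.eq_ofNat_of_zero_le hm
      rw [hk]
      have := qB_zero k
      simpa using this
    · unfold TT
      rw [prod_zero _ _ _ ν hν le_rfl, mul_zero]
      unfold mm
      simp only [h0]
      rw [cum_alph s _ hs le_rfl]
      simp [alph]
      omega
  · intro n hn
    by_contra hc
    apply hn
    have h1 := supp_bound hν _ _ n (right_ne_zero_of_mul hc)
    rw [cum_alph s _ hs hν] at h1
    funext k
    have := le_NN_one n k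
    simp only [alph] at h1
    omega

lemma HH_Gam (hν : 1 ≤ ν) (b : ℕ) (hb : b ≤ ν) (k : ℕ) : ∀ (s : ℕ) (e : ℤ), s ≤ ν →
    HH ν b (k + 1) e (List.replicate s 0 ++ List.replicate (ν - s) 1) = Gam ν k s b e := by
  induction k with
  | zero =>
    intro s e hs
    have := HH_base hν s b hs hb e
    simpa [Gam] using this
  | succ k ih =>
    intro s e hs
    rw [HH_rec b _ e (by push_cast; omega) s hs, Gam]
    apply Finset.sum_congr rfl
    intro f _
    rw [← ih (ν - f) (e + 1) (by omega)]
    push_cast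
    rw [add_sub_cancel_right]

lemma Gam_last (k : ℕ) : ∀ (s b : ℕ) (e : ℤ), s ≤ ν → b ≤ ν →
    Gam ν (k + 1) s b e = ∑ f ∈ Finset.range (b + 1), RatFunc.X ^ (f * (e + k + 1) : ℤ) *
      Gam ν k s (ν - f) e := by
  induction k with
  | zero =>
    intro s b e hs hb
    simp only [Gam]
    have aux : ∀ s b : ℕ, s ≤ ν → b ≤ ν → ∀ (P : ℕ → ℕ → Prop) [∀ f s, Decidable (P f s)], (∀ f ≤ s, P f s ↔ f ≤ b) →
        ∑ f ∈ Finset.range (s + 1), (RatFunc.X : K) ^ (f * (e + 1) : ℤ) * (if P f s then 1 else 0) =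
        ∑ f ∈ Finset.range (ν + 1), if f ≤ s ∧ f ≤ b then RatFunc.X ^ (f * (e + 1) : ℤ) else 0 := by
      intro s b hs hb P _ hP
      rw [← Finset.sum_subset (Finset.range_mono (by omega : s + 1 ≤ ν + 1))]
      · apply Finset.sum_congr rfl
        intro f hf
        have hf := Finset.mem_range.mp hf
        have := hP f (by omega)
        by_cases h : f ≤ b
        · rw [if_pos (this.mpr h), if_pos ⟨by omega, h⟩, mul_one]
        · rw [if_neg (fun h' => h (this.mp h')), if_neg (fun h' => h h'.2), mul_zero]
      · intro f _ hf
        rw [Finset.mem_range] at hf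
        rw [if_neg (by omega)]
    have h1 := aux s b hs hb (fun f _ => ν ≤ ν - f + b) (by intro f hf; omega)
    have h2 := aux b s hb hs (fun f _ => ν ≤ s + (ν - f)) (by intro f hf; omega)
    simp only [Nat.cast_zero, add_zero]
    rw [h1, h2]
    apply Finset.sum_congr rfl
    intro f _
    simp only [and_comm]
  | succ k ih =>
    intro s b e hs hb
    rw [Gam]
    have h1 : ∀ f ∈ Finset.range (s + 1), RatFunc.X ^ (f * (e + 1) : ℤ) *
        Gam ν (k + 1) (ν - f) b (e + 1) = ∑ g ∈ Finset.range (b + 1),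
        RatFunc.X ^ (f * (e + 1) : ℤ) * (RatFunc.X ^ (g * (e + 1 + k + 1) : ℤ) *
          Gam ν k (ν - f) (ν - g) (e + 1)) := by
      intro f _
      rw [ih (ν - f) b (e + 1) (by omega) hb, Finset.mul_sum]
    rw [Finset.sum_congr rfl h1, Finset.sum_comm]
    apply Finset.sum_congr rfl
    intro g _
    rw [Gam, Finset.mul_sum]
    apply Finset.sum_congr rfl
    intro f _
    have : (e + ((k + 1 : ℕ) : ℤ) + 1) = e + 1 + k + 1 := by push_cast; ring
    rw [this]; ring

/-! ### Gordon paths -/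

lemma gordon_finite (ν n s b : ℕ) : {f : ℕ → ℕ | IsGordon ν n s b f}.Finite := by
  apply Set.Finite.of_injOn (f := fun f : ℕ → ℕ => fun i : Fin (n + 1) => f i)
    (t := Set.Iic (fun _ : Fin (n + 1) => s + ν)) _ _ (Set.finite_Iic _)
  · rintro f ⟨h0, h1, h2, h3⟩ i
    simp only
    rcases Nat.eq_zero_or_pos (i : ℕ) with h | h
    · rw [h, h0]; omega
    · have := h2 ((i : ℕ) - 1) (by omega)
      rw [Nat.sub_add_cancel h] at this
      omega
  · rintro f ⟨h0, h1, h2, h3⟩ g ⟨h0', h1', h2', h3'⟩ hfg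
    funext k
    by_cases hk : n < k
    · rw [h3 k hk, h3' k hk]
    · exact congrFun hfg ⟨k, by omega⟩

lemma G_nat {F : Type*} [Field F] (ν n s b : ℕ) (q : F) : G ν 0 (n : ℤ) s b q =
    ∑ᶠ f : ℕ → ℕ, if IsGordon ν n s b f then q ^ gwt 0 n f else 0 := by
  unfold G; simp

lemma G_zero (ν s b : ℕ) (q : K) : G ν 0 ((0 : ℕ) : ℤ) s b q = if s = b then 1 else 0 := by
  rw [G_nat, finsum_eq_single _ (fun k => if k = 0 then s else 0)]
  · by_cases h : s = b
    · rw [if_pos h, if_pos]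
      · simp [gwt]
      · refine ⟨by simp, by simpa using h, by simp, ?_⟩
        intro k hk
        exact if_neg (by omega)
    · rw [if_neg h, if_neg]
      rintro ⟨h0, h1, -⟩
      simp at h1; exact h h1
  · intro f hf
    rw [if_neg]
    rintro ⟨h0, h1, h2, h3⟩
    apply hf
    funext k
    by_cases hk : k = 0
    · simp [hk, h0]
    · rw [if_neg hk, h3 k (by omega)]

lemma gwt_succ (n : ℕ) (f g : ℕ → ℕ) (h : ∀ k ≤ n, f k = g k) :
    gwt 0 (n + 1) f = n * g n + gwt 0 n g := by
  unfold gwt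
  rcases Nat.eq_zero_or_pos n with rfl | hn
  · have : Finset.Ioo 0 (0 + 1) = ∅ := by decide
    simp [this]
  · have : Finset.Ioo 0 (n + 1) = insert n (Finset.Ioo 0 n) := by
      ext k; simp only [Finset.mem_Ioo, Finset.mem_insert]; omega
    rw [this, Finset.sum_insert (by simp), h n le_rfl, zero_add]
    congr 1
    apply Finset.sum_congr rfl
    intro k hk
    rw [h k (Finset.mem_Ioo.mp hk).2.le]

lemma G_succ (ν n s b : ℕ) (hb : b ≤ ν) (q : K) (hq : q ≠ 0) :
    G ν 0 ((n + 1 : ℕ) : ℤ) s (ν - b) q =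
      ∑ h ∈ Finset.range (b + 1), q ^ (n * h : ℤ) * G ν 0 (n : ℤ) s h q := by
  have h1 : G ν 0 ((n + 1 : ℕ) : ℤ) s (ν - b) q =
      ∑ᶠ f ∈ {f : ℕ → ℕ | IsGordon ν (n + 1) s (ν - b) f}, q ^ gwt 0 (n + 1) f := by
    rw [G_nat, finsum_mem_def]
    apply finsum_congr
    intro f
    simp [Set.indicator_apply]
  have h2 : ∑ᶠ f ∈ {f : ℕ → ℕ | IsGordon ν (n + 1) s (ν - b) f}, q ^ gwt 0 (n + 1) f =
      ∑ᶠ g ∈ {g : ℕ → ℕ | IsGordon ν n s (g n) g ∧ g n ≤ b}, q ^ (n * g n + gwt 0 n g : ℤ) := by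
    apply finsum_mem_eq_of_bijOn (fun f => Function.update f (n + 1) 0)
    · refine ⟨?_, ?_, ?_⟩
      · rintro f ⟨h0, h1, h2, h3⟩
        have hu : ∀ k ≤ n, Function.update f (n + 1) 0 k = f k := by
          intro k hk; rw [Function.update_of_ne (by omega)]
        refine ⟨⟨(hu 0 (by omega)).trans h0, rfl, ?_, ?_⟩, ?_⟩
        · intro k hk
          beta_reduce
          rw [hu k (by omega), hu (k + 1) (by omega)]
          exact h2 k (by omega)
        · intro k hk
          by_cases hk' : k = n + 1
          · rw [hk']; simp
          · beta_reduce
            rw [Function.update_of_ne hk', h3 k (by omega)]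
        · beta_reduce
          rw [hu n le_rfl]
          have := h2 n (by omega)
          omega
      · rintro f ⟨h0, h1, h2, h3⟩ g ⟨h0', h1', h2', h3'⟩ hfg
        funext k
        by_cases hk : k = n + 1
        · rw [hk, h1, h1']
        · have := congrFun hfg k
          simpa [Function.update_of_ne hk] using this
      · rintro g ⟨⟨h0, -, h2, h3⟩, hg⟩
        have hu : ∀ k ≤ n, Function.update g (n + 1) (ν - b) k = g k := by
          intro k hk; rw [Function.update_of_ne (by omega)]
        refine ⟨Function.update g (n + 1) (ν - b), ⟨by rw [hu 0 (by omega), h0], by simp, ?_, ?_⟩, ?_⟩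
        · intro k hk
          by_cases hk' : k = n
          · subst hk'
            rw [hu k le_rfl]; simp; omega
          · rw [hu k (by omega), hu (k + 1) (by omega)]
            exact h2 k (by omega)
        · intro k hk
          rw [Function.update_of_ne (by omega), h3 k (by omega)]
        · simp only [Function.update_idem]
          rw [← h3 (n + 1) (by omega), Function.update_eq_self]
    · intro f _
      congr 1
      exact gwt_succ n f _ (fun k hk => by rw [Function.update_of_ne (by omega)])
  have h3 : ∑ᶠ g ∈ {g : ℕ → ℕ | IsGordon ν n s (g n) g ∧ g n ≤ b}, q ^ (n * g n + gwt 0 n g : ℤ) =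
      ∑ᶠ g : ℕ → ℕ, ∑ h ∈ Finset.range (b + 1),
        q ^ (n * h : ℤ) * (if IsGordon ν n s h g then q ^ gwt 0 n g else 0) := by
    rw [finsum_mem_def]
    apply finsum_congr
    intro g
    have hz : ∀ h, h ≠ g n → ¬ IsGordon ν n s h g := fun h hh hg => hh hg.2.1.symm
    by_cases hg : g n ≤ b
    · rw [Finset.sum_eq_single_of_mem (g n) (Finset.mem_range.mpr (by omega))]
      · by_cases hG : IsGordon ν n s (g n) g
        · rw [if_pos hG, Set.indicator_of_mem (by exact ⟨hG, hg⟩), zpow_add₀ hq]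
        · rw [if_neg hG, Set.indicator_of_notMem (by exact fun h => hG h.1), mul_zero]
      · intro h _ hh
        rw [if_neg (hz h hh), mul_zero]
    · rw [Set.indicator_of_notMem (by exact fun h => hg h.2), Finset.sum_eq_zero]
      intro h hh
      have := Finset.mem_range.mp hh
      rw [if_neg (hz h (by omega)), mul_zero]
  rw [h1, h2, h3, finsum_sum_comm]
  · apply Finset.sum_congr rfl
    intro h _
    rw [G_nat, mul_finsum]
  · intro h _
    apply (gordon_finite ν n s h).subset
    intro g hg
    by_contra hc
    apply hg
    have : ¬ IsGordon ν n s h g := hc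
    simp [this]

lemma G_Gam (k : ℕ) (s : ℕ) (hs : s ≤ ν) : ∀ b ≤ ν,
    G ν 0 ((k + 1 : ℕ) : ℤ) (ν - s) (ν - b) (RatFunc.X : K) = Gam ν k s b 0 := by
  induction k with
  | zero =>
    intro b hb
    rw [G_succ _ _ _ _ hb _ X_ne]
    simp only [G_zero, Gam]
    by_cases h : ν ≤ s + b
    · rw [if_pos h, Finset.sum_eq_single_of_mem (ν - s) (Finset.mem_range.mpr (by omega))]
      · simp
      · intro h _ hh
        rw [if_neg (Ne.symm hh), mul_zero]
    · rw [if_neg h, Finset.sum_eq_zero]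
      intro h hh
      have := Finset.mem_range.mp hh
      rw [if_neg (by omega), mul_zero]
  | succ k ih =>
    intro b hb
    rw [G_succ _ _ _ _ hb _ X_ne, Gam_last k s b 0 hs hb]
    apply Finset.sum_congr rfl
    intro f hf
    have := Finset.mem_range.mp hf
    rw [← ih (ν - f) (by omega)]
    have e1 : ν - (ν - f) = f := by omega
    rw [e1]
    congr 2
    push_cast; ring

lemma glue (b : ℕ) (hb : b ≤ ν) (M : ℕ) : ∀ (R k s : ℕ), M + R = k + 1 → s ≤ ν →
    ∑ s' ∈ Finset.range (ν + 1), G ν 0 (M : ℤ) s' (ν - s) (RatFunc.X : K)⁻¹ *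
      G ν 0 (R : ℤ) s' (ν - b) RatFunc.X = Gam ν k s b (-(M : ℤ)) := by
  induction M with
  | zero =>
    intro R k s h hs
    simp only [G_zero]
    rw [Finset.sum_eq_single_of_mem (ν - s) (Finset.mem_range.mpr (by omega))]
    · obtain rfl : R = k + 1 := by omega
      rw [if_pos rfl, one_mul, G_Gam k s hs b hb]; simp
    · intro s' _ h'
      rw [if_neg h', zero_mul]
  | succ M ih =>
    intro R k s h hs
    have h1 : ∀ s' ∈ Finset.range (ν + 1), G ν 0 ((M + 1 : ℕ) : ℤ) s' (ν - s) (RatFunc.X : K)⁻¹ *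
        G ν 0 (R : ℤ) s' (ν - b) RatFunc.X = ∑ f ∈ Finset.range (s + 1),
        (RatFunc.X : K)⁻¹ ^ (M * f : ℤ) * (G ν 0 (M : ℤ) s' f (RatFunc.X : K)⁻¹ *
        G ν 0 (R : ℤ) s' (ν - b) RatFunc.X) := by
      intro s' _
      rw [G_succ _ _ _ _ hs _ (inv_ne_zero X_ne), Finset.sum_mul]
      apply Finset.sum_congr rfl
      intro f _; ring
    rw [Finset.sum_congr rfl h1, Finset.sum_comm]
    simp only [← Finset.mul_sum]
    rcases k with _ | k
    · obtain rfl : M = 0 := by omega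
      obtain rfl : R = 0 := by omega
      simp only [G_zero, Gam]
      have h2 : ∀ f ∈ Finset.range (s + 1), (RatFunc.X : K)⁻¹ ^ (((0 : ℕ) : ℤ) * f : ℤ) *
          ∑ s' ∈ Finset.range (ν + 1), ((if s' = f then 1 else 0) * if s' = ν - b then 1 else 0) =
          if f = ν - b then 1 else 0 := by
        intro f hf
        have := Finset.mem_range.mp hf
        rw [Finset.sum_eq_single_of_mem f (Finset.mem_range.mpr (by omega))]
        · simp
        · intro s' _ h'
          rw [if_neg h', zero_mul]
      rw [Finset.sum_congr rfl h2, Finset.sum_ite_eq']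
      congr 1
      simp only [Finset.mem_range, eq_iff_iff]
      omega
    · rw [Gam]
      apply Finset.sum_congr rfl
      intro f hf
      have := Finset.mem_range.mp hf
      have e1 : -((M + 1 : ℕ) : ℤ) + 1 = -(M : ℤ) := by push_cast; ring
      have e2 : ν - (ν - f) = f := by omega
      rw [e1, ← ih R k (ν - f) (by omega) (by omega), e2]
      congr 1
      rw [inv_zpow, ← zpow_neg]
      congr 1; ring

lemma FpolyM_eq (s b L M : ℕ) (hs : s ≤ ν) :
    FpolyM ν s b L M (RatFunc.X : K) =
      HH ν b L (-(M : ℤ)) (List.replicate s 0 ++ List.replicate (ν - s) 1) := by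
  unfold FpolyM HH FF
  apply finsum_congr
  intro n
  unfold TT
  congr 1
  · congr 1
    unfold ex expAG
    have h1 : ∑ i ∈ Finset.Icc (s + 1) ν, (NN n i : ℤ) =
        ∑ l ∈ Finset.Icc 1 ν, (NN n l : ℤ) - ∑ l ∈ Finset.Icc 1 s, (NN n l : ℤ) := by
      rw [eq_sub_iff_add_eq, add_comm, ← Finset.sum_union]
      · apply Finset.sum_congr _ (fun _ _ => rfl)
        ext l; simp only [Finset.mem_union, Finset.mem_Icc]; omega
      · rw [Finset.disjoint_left]
        intro l; simp only [Finset.mem_Icc]; omega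
    push_cast
    rw [h1, sumNN, sumNN, add_sub_assoc, Finset.mul_sum, ← Finset.sum_sub_distrib,
      ← Finset.sum_sub_distrib]
    congr 1
    apply Finset.sum_congr rfl
    intro k _
    rw [cum_alph s _ hs (by omega)]
    have h2 : min (ν : ℤ) ((k : ℕ) + 1 : ℤ) = (k : ℕ) + 1 := by have := k.2; omega
    have h3 : alph ((k : ℕ) + 1) s = (k : ℕ) + 1 - min (s : ℤ) ((k : ℕ) + 1 : ℤ) := by
      unfold alph; push_cast; omega
    rw [h2, h3]; push_cast; ring
  · apply Finset.prod_congr rfl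
    intro i _
    congr 1
    unfold mm
    beta_reduce
    rw [cum_alph s _ hs (by omega)]
    push_cast; ring

end AG

theorem stmt_18 (ν : ℕ) (hν : 1 ≤ ν) (s b : ℕ) (hs : s ≤ ν) (hb : b ≤ ν)
    (L : ℕ) (hL : 2 ≤ L) (M : ℕ) (hM : M ≤ L) :
    FpolyM ν s b L M (RatFunc.X : K) =
      ∑ s' ∈ Finset.range (ν + 1),
        G ν 0 (M : ℤ) s' (ν - s) (RatFunc.X : K)⁻¹ * G ν 0 ((L : ℤ) - M) s' (ν - b) RatFunc.X := by
  obtain ⟨k, rfl⟩ : ∃ k, L = k + 1 := ⟨L - 1, by omega⟩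
  rw [AG.FpolyM_eq s b (k + 1) M hs]
  have h1 := AG.HH_Gam hν b hb k s (-(M : ℤ)) hs
  have h2 := AG.glue b hb M (k + 1 - M) k s (by omega) hs
  have h3 : (((k + 1 : ℕ) : ℤ) - (M : ℤ)) = ((k + 1 - M : ℕ) : ℤ) := by omega
  rw [h3, h2, ← h1]
  push_cast
  rfl

end
end
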